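/- There is a constant c (independent of the automaton) such that every GFG Rabin automaton with n states whose language is recognized by some deterministic Büchi automaton has an equivalent deterministic Büchi automaton with at most c·n² states. -/

import Mathlib

namespace GFG

/-- The structure of a nondeterministic automaton on infinite words:
alphabet `A`, states `Q`, initial states and transition function.
The acceptance condition is kept separate, as a predicate on the set
of states visited infinitely often. -/
structure Auto (A Q : Type) where
  init : Set Q
  next : Q → A → Set Q

variable {A Q Mem : Type}

/-- `r` is a run of the automaton `M` on the infinite word `w`. -/
def Auto.IsRun (M : Auto A Q) (w : ℕ → A) (r : ℕ → Q) : Prop :=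
  r 0 ∈ M.init ∧ ∀ i, r (i + 1) ∈ M.next (r i) (w i)

/-- The set of states occurring infinitely often in `r`. -/
def InfOcc (r : ℕ → Q) : Set Q := {q | ∀ n, ∃ m, n ≤ m ∧ r m = q}

/-- The language of `M` with acceptance condition `acc` (a predicate on `inf(r)`). -/
def Auto.Lang (M : Auto A Q) (acc : Set Q → Prop) : Set (ℕ → A) :=
  {w | ∃ r, M.IsRun w r ∧ acc (InfOcc r)}

/-- `M` is deterministic: one initial state and at most one successor per state/letter. -/
def Auto.IsDet (M : Auto A Q) : Prop :=
  (∃ q0, M.init = {q0}) ∧ ∀ q a, (M.next q a).Subsingleton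

/-- `A^q`: the automaton `M` with set of initial states `{q}`. -/
def Auto.withInit (M : Auto A Q) (q : Q) : Auto A Q := ⟨{q}, M.next⟩

/-- Büchi condition: `inf(r) ∩ α ≠ ∅`. -/
def BuchiAcc (α : Set Q) (S : Set Q) : Prop := (S ∩ α).Nonempty

/-- co-Büchi condition: `inf(r) ∩ α = ∅`. -/
def CoBuchiAcc (α : Set Q) (S : Set Q) : Prop := S ∩ α = ∅

/-- Rabin condition with bad sets `E i` and good sets `F i`. -/
def RabinAcc {ι : Type} (E F : ι → Set Q) (S : Set Q) : Prop :=
  ∃ i, S ∩ E i = ∅ ∧ (S ∩ F i).Nonempty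

/-- Streett condition with pairs `(E i, F i)`. -/
def StreettAcc {ι : Type} (E F : ι → Set Q) (S : Set Q) : Prop :=
  ∀ i, S ∩ E i = ∅ ∨ (S ∩ F i).Nonempty

/-- Parity condition: the minimal priority seen infinitely often is even. -/
def ParityAcc (c : Q → ℕ) (S : Set Q) : Prop := Even (sInf (c '' S))

/-- The prefix of length `n` of the infinite word `w`, as a list. -/
def prefixWord (w : ℕ → A) (n : ℕ) : List A := (List.range n).map w

/-- The run induced by a strategy `g : A* → Q` on the word `w`:
`g(ε), g(a₁), g(a₁a₂), …`. -/
def StrategyRun (g : List A → Q) (w : ℕ → A) : ℕ → Q := fun n => g (prefixWord w n)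

/-- `g` witnesses GFGness of `M` (with acceptance `acc`): for every word `w` the
induced sequence is a run of `M` on `w`, accepting whenever `w ∈ L(M)`. -/
def IsGFGStrategy (M : Auto A Q) (acc : Set Q → Prop) (g : List A → Q) : Prop :=
  ∀ w : ℕ → A, M.IsRun w (StrategyRun g w) ∧
    (w ∈ M.Lang acc → acc (InfOcc (StrategyRun g w)))

/-- `M` is good for games. -/
def IsGFG (M : Auto A Q) (acc : Set Q → Prop) : Prop :=
  ∃ g : List A → Q, IsGFGStrategy M acc g

/-- `M` is unambiguous: every word of the language has exactly one accepting run. -/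
def Unambiguous (M : Auto A Q) (acc : Set Q → Prop) : Prop :=
  ∀ w ∈ M.Lang acc, ∃! r : ℕ → Q, M.IsRun w r ∧ acc (InfOcc r)

/-- `M` is determinizable by pruning. -/
def DetByP (M : Auto A Q) (acc : Set Q → Prop) : Prop :=
  ∃ q0 ∈ M.init, ∃ next' : Q → A → Set Q,
    (∀ q a, next' q a ⊆ M.next q a ∧ (next' q a).Subsingleton) ∧
    (⟨{q0}, next'⟩ : Auto A Q).Lang acc = M.Lang acc

/-- A finite-state strategy (transducer): memories `Mem`, initial memory `m0`,
memory update function `upd` and output function `out`. -/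
structure Transducer (A Q Mem : Type) where
  m0 : Mem
  upd : Mem → A → Mem
  out : Mem → Q

namespace Transducer

variable (T : Transducer A Q Mem)

/-- The memory reached from `m` after reading the finite word `u`. -/
def run (m : Mem) (u : List A) : Mem := u.foldl T.upd m

/-- The strategy generated by the transducer: `u ↦ τ(ρ(m₀, u))`. -/
def strategy : List A → Q := fun u => T.out (T.run T.m0 u)

/-- The deterministic automaton `A_g`, with initial memory replaced by `m`. -/
def autoFrom (m : Mem) : Auto A Mem := ⟨{m}, fun m' a => {T.upd m' a}⟩

/-- The deterministic automaton `A_g` itself. -/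
def auto : Auto A Mem := T.autoFrom T.m0

/-- The acceptance condition `α_g` of `A_g`, obtained from `acc` by replacing each
set `F ⊆ Q` appearing in it by `{m | τ(m) ∈ F}`. -/
def accG (acc : Set Q → Prop) : Set Mem → Prop := fun S => acc (T.out '' S)

/-- `m` is reachable in `A_g` from the initial memory. -/
def Reachable (m : Mem) : Prop := ∃ u : List A, T.run T.m0 u = m

/-- The set of memories visited along the path of `A_g` that starts at `m` and
reads the finite word `u` (both endpoints included). -/
def pathStates (m : Mem) (u : List A) : Set Mem :=
  {m' | ∃ v : List A, v <+: u ∧ T.run m v = m'}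

/-- `P_{src → dst}`: the (words inducing the) finite paths of `A_g` from `src` to `dst`. -/
def PathSet (src dst : Mem) : Set (List A) :=
  {u : List A | u ≠ [] ∧ T.run src u = dst}

/-- Every combination of paths from `P_{src → dst}` satisfies `α_g`. -/
def AllCombosAcc (acc : Set Q → Prop) (src dst : Mem) : Prop :=
  ∀ S : Set (List A), S.Nonempty → S ⊆ T.PathSet src dst →
    T.accG acc (⋃ u ∈ S, T.pathStates src u)

/-- `P_{src → dst}` is empty, or every combination of its paths satisfies `α_g`. -/
def GoodPathSet (acc : Set Q → Prop) (src dst : Mem) : Prop :=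
  T.PathSet src dst = ∅ ∨ T.AllCombosAcc acc src dst

/-- `m` is replaceable by `m'`: the set `P_{m' → m}` of paths of `A_g` from `m'`
to `m` is empty, or every combination of its paths satisfies `α_g`. -/
def Replaceable (acc : Set Q → Prop) (m m' : Mem) : Prop :=
  T.GoodPathSet acc m' m

/-- The transition `(q, a, q')` is used by the strategy. -/
def Uses (q : Q) (a : A) (q' : Q) : Prop :=
  ∃ u : List A, T.strategy u = q ∧ T.strategy (u ++ [a]) = q'

/-- The nonempty word `u` induces a cycle of `A_g` through the memory `m`. -/
def CycleThrough (m : Mem) (u : List A) : Prop := u ≠ [] ∧ T.run m u = m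

/-- The cycle of `A_g` through `m` induced by `u` is accepting. -/
def AccCycle (acc : Set Q → Prop) (m : Mem) (u : List A) : Prop :=
  T.CycleThrough m u ∧ T.accG acc (T.pathStates m u)

/-- The cycle of `A_g` through `m` induced by `u` is rejecting. -/
def RejCycle (acc : Set Q → Prop) (m : Mem) (u : List A) : Prop :=
  T.CycleThrough m u ∧ ¬ T.accG acc (T.pathStates m u)

/-- The cycle of `A_g` through `m` induced by `u` is `q`-exclusive accepting:
it is accepting, but its set of memories minus the memories of `q` is not. -/
def ExclAccCycle (acc : Set Q → Prop) (q : Q) (m : Mem) (u : List A) : Prop :=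
  T.CycleThrough m u ∧ T.accG acc (T.pathStates m u) ∧
    ¬ T.accG acc (T.pathStates m u \ {m' : Mem | T.out m' = q})

end Transducer

/-- `M` is weakly tight with respect to `T`: every transition of `M` is used. -/
def WeaklyTightWrt (M : Auto A Q) (T : Transducer A Q Mem) : Prop :=
  ∀ q a q', q' ∈ M.next q a → T.Uses q a q'

/-- `M` is tight with respect to `T`: every transition of `M` is used, and no memory
is replaceable by a different memory of the same state. -/
def TightWrt (M : Auto A Q) (acc : Set Q → Prop) (T : Transducer A Q Mem) : Prop :=
  WeaklyTightWrt M T ∧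
  ∀ m m' : Mem, m ≠ m' → T.out m = T.out m' → ¬ T.Replaceable acc m m'

/-- `M` is tight: tight with respect to some finite-state strategy witnessing its GFGness. -/
def Tight (M : Auto A Q) (acc : Set Q → Prop) : Prop :=
  ∃ (Mem : Type) (_ : Fintype Mem) (T : Transducer A Q Mem),
    IsGFGStrategy M acc T.strategy ∧ TightWrt M acc T

/-- `M` is weakly tight: weakly tight with respect to some finite-state strategy
witnessing its GFGness. -/
def WeaklyTight (M : Auto A Q) (acc : Set Q → Prop) : Prop :=
  ∃ (Mem : Type) (_ : Fintype Mem) (T : Transducer A Q Mem),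
    IsGFGStrategy M acc T.strategy ∧ WeaklyTightWrt M T

/-- A Rabin automaton `M` (with pairs `(E i, F i)`) is strongly tight with respect to `T`:
tight, and every state appearing in some good set has a `q`-exclusive accepting cycle
in `A_g`. -/
def StronglyTightWrt {ι : Type} (M : Auto A Q) (E F : ι → Set Q)
    (T : Transducer A Q Mem) : Prop :=
  TightWrt M (RabinAcc E F) T ∧
  ∀ q : Q, (∃ i, q ∈ F i) →
    ∃ (m : Mem) (u : List A), T.ExclAccCycle (RabinAcc E F) q m u

/-- A Rabin automaton is strongly tight: strongly tight with respect to some finite-state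
strategy witnessing its GFGness. -/
def StronglyTight {ι : Type} (M : Auto A Q) (E F : ι → Set Q) : Prop :=
  ∃ (Mem : Type) (_ : Fintype Mem) (T : Transducer A Q Mem),
    IsGFGStrategy M (RabinAcc E F) T.strategy ∧ StronglyTightWrt M E F T

/-- One-step reachability in the transition graph of `M`. -/
def Auto.Step (M : Auto A Q) (q q' : Q) : Prop := ∃ a, q' ∈ M.next q a

/-- Reachability in the transition graph of `M`. -/
def Auto.Reach (M : Auto A Q) : Q → Q → Prop := Relation.ReflTransGen M.Step

/-- The Büchi automaton `(M, α)` is weak: each strongly connected component is either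
contained in `α` or disjoint from `α`. -/
def Auto.IsWeak (M : Auto A Q) (α : Set Q) : Prop :=
  ∀ q q', M.Reach q q' → M.Reach q' q → (q ∈ α ↔ q' ∈ α)

/-! ### Utilities -/

/-- Deterministic run. -/
def drun {X B : Type} (f : X → B → X) (x : X) (w : ℕ → B) : ℕ → X
  | 0 => x
  | n + 1 => f (drun f x w n) (w n)

/-- Prepend a letter. -/
def consW {B : Type} (a : B) (w : ℕ → B) : ℕ → B
  | 0 => a
  | n + 1 => w n

theorem consW_tail {B : Type} (w : ℕ → B) : consW (w 0) (fun n => w (n + 1)) = w := by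
  funext n; cases n <;> rfl

theorem drun_shift {X B : Type} (f : X → B → X) (x : X) (w : ℕ → B) (k n : ℕ) :
    drun f x w (n + k) = drun f (drun f x w k) (fun i => w (i + k)) n := by
  induction n with
  | zero => simp [drun]
  | succ n ih => rw [Nat.add_right_comm]; simp only [drun]; rw [ih]

theorem infOcc_shift {X : Type} (r : ℕ → X) (k : ℕ) : InfOcc (fun n => r (n + k)) = InfOcc r := by
  ext q; constructor
  · intro h n
    obtain ⟨m, hm, e⟩ := h n
    exact ⟨m + k, by omega, e⟩
  · intro h n
    obtain ⟨m, hm, e⟩ := h (n + k)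
    exact ⟨m - k, by omega, by simpa [Nat.sub_add_cancel (show k ≤ m by omega)] using e⟩

theorem infOcc_pigeon {X : Type} [Finite X] (r : ℕ → X) (p : ℕ → Prop)
    (h : ∀ n, ∃ m, n ≤ m ∧ p m) : ∃ x, ∀ n, ∃ m, n ≤ m ∧ p m ∧ r m = x := by
  by_contra hc
  push Not at hc
  choose b hb using hc
  cases nonempty_fintype X
  obtain ⟨m, hm, hp⟩ := h (Finset.univ.sup b)
  exact hb (r m) m ((Finset.le_sup (Finset.mem_univ (r m))).trans hm) hp rfl

theorem infOcc_comp {X Y : Type} [Finite X] (r : ℕ → X) (f : X → Y) :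
    InfOcc (fun n => f (r n)) = f '' InfOcc r := by
  ext y; constructor
  · intro h
    obtain ⟨x, hx⟩ := infOcc_pigeon r (fun m => f (r m) = y) h
    obtain ⟨m, -, h1, h2⟩ := hx 0
    exact ⟨x, fun n => by obtain ⟨m, a, -, b⟩ := hx n; exact ⟨m, a, b⟩, by rw [← h2, h1]⟩
  · rintro ⟨x, hx, rfl⟩ n
    obtain ⟨m, a, b⟩ := hx n
    exact ⟨m, a, by simp [b]⟩

theorem infOcc_eventually {X : Type} [Finite X] (r : ℕ → X) :
    ∃ k, ∀ n, k ≤ n → r n ∈ InfOcc r := by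
  by_contra hc
  push Not at hc
  obtain ⟨x, hx⟩ := infOcc_pigeon r (fun m => r m ∉ InfOcc r) hc
  obtain ⟨m, -, h1, h2⟩ := hx 0
  exact h1 (h2 ▸ fun n => by obtain ⟨m, a, -, b⟩ := hx n; exact ⟨m, a, b⟩)

theorem buchi_iff {X : Type} [Finite X] (r : ℕ → X) (β : Set X) :
    BuchiAcc β (InfOcc r) ↔ ∀ n, ∃ m, n ≤ m ∧ r m ∈ β := by
  constructor
  · rintro ⟨q, hq, hb⟩ n
    obtain ⟨m, hm, e⟩ := hq n
    exact ⟨m, hm, e ▸ hb⟩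
  · intro h
    obtain ⟨x, hx⟩ := infOcc_pigeon r (fun m => r m ∈ β) h
    obtain ⟨m, -, h1, h2⟩ := hx 0
    exact ⟨x, fun n => by obtain ⟨m, a, -, b⟩ := hx n; exact ⟨m, a, b⟩, h2 ▸ h1⟩

theorem rabin_iUnion {ι κ : Type} (E F : ι → Set Q) (S : κ → Set Q)
    (h : RabinAcc E F (⋃ k, S k)) : ∃ k, RabinAcc E F (S k) := by
  obtain ⟨i, h1, q, hq, hf⟩ := h
  obtain ⟨k, hk⟩ := Set.mem_iUnion.1 hq
  refine ⟨k, i, ?_, q, hk, hf⟩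
  rw [← Set.subset_empty_iff, ← h1]
  exact Set.inter_subset_inter_left _ (Set.subset_iUnion S k)

theorem rabin_union {ι : Type} (E F : ι → Set Q) (S T : Set Q)
    (h : RabinAcc E F (S ∪ T)) : RabinAcc E F S ∨ RabinAcc E F T := by
  rw [Set.union_eq_iUnion] at h
  obtain ⟨k, hk⟩ := rabin_iUnion E F _ h
  cases k
  · exact Or.inr hk
  · exact Or.inl hk

theorem prefixWord_succ (w : ℕ → A) (n : ℕ) : prefixWord w (n + 1) = prefixWord w n ++ [w n] := by
  simp [prefixWord, List.range_succ]

theorem prefixWord_zero (w : ℕ → A) : prefixWord w 0 = [] := rfl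

/-- There is an `R`-path of length `n` from `x` into the set `G`. -/
def PathTo {X : Type} (R : X → X → Prop) (G : X → Prop) : ℕ → X → Prop
  | 0, x => G x
  | n + 1, x => ∃ y, R x y ∧ PathTo R G n y

theorem pathTo_of_transGen {X : Type} {R : X → X → Prop} {G : X → Prop} {x y : X}
    (h : Relation.TransGen R x y) (hy : G y) : ∃ n, PathTo R G (n + 1) x := by
  induction h using Relation.TransGen.head_induction_on with
  | single h => exact ⟨0, _, h, hy⟩
  | head h _ ih => obtain ⟨n, hn⟩ := ih; exact ⟨n + 1, _, h, hn⟩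

theorem inf_path_nat {X : Type} (R : X → X → Prop) (Inv : X → Prop) (G : ℕ → X → Prop)
    (H : ∀ x, Inv x → ∀ k, ∃ y, Relation.TransGen R x y ∧ G k y ∧ Inv y) (x0 : X) (h0 : Inv x0) :
    ∃ f : ℕ → X, f 0 = x0 ∧ (∀ n, R (f n) (f (n + 1))) ∧ ∀ k, ∃ m, k ≤ m ∧ G k (f m) := by
  classical
  let G' : ℕ → X → Prop := fun k x => G k x ∧ Inv x
  let S := {s : X × ℕ × ℕ // PathTo R (G' s.2.1) s.2.2 s.1}
  have H' : ∀ x, Inv x → ∀ k, ∃ n, PathTo R (G' k) (n + 1) x := by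
    intro x hx k
    obtain ⟨y, h1, h2⟩ := H x hx k
    exact pathTo_of_transGen h1 h2
  have step : ∀ s : S, ∃ s' : S, R s.1.1 s'.1.1 ∧
      (s.1.2.2 = 0 → s'.1.2.1 = s.1.2.1 + 1) ∧
      (∀ m, s.1.2.2 = m + 1 → s'.1.2.1 = s.1.2.1 ∧ s'.1.2.2 = m) := by
    rintro ⟨⟨x, k, n⟩, hs⟩
    cases n with
    | zero =>
      obtain ⟨n, y, h1, h2⟩ := H' x hs.2 (k + 1)
      exact ⟨⟨(y, k + 1, n), h2⟩, h1, fun _ => rfl, fun m hm => by simp at hm⟩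
    | succ n =>
      obtain ⟨y, h1, h2⟩ := hs
      exact ⟨⟨(y, k, n), h2⟩, h1, fun hm => by simp at hm, fun m hm => by
        simp at hm; simp [hm]⟩
  choose nx hR hz hs using step
  obtain ⟨n0, hn0⟩ := H' x0 h0 0
  let s0 : S := ⟨(x0, 0, n0 + 1), hn0⟩
  let F : ℕ → S := fun n => nx^[n] s0
  have hF : ∀ n, F (n + 1) = nx (F n) := fun n => Function.iterate_succ_apply' nx n s0
  have hit : ∀ n t, (F t).1.2.2 = n →
      G' (F t).1.2.1 (F (t + n)).1.1 ∧ (F (t + n + 1)).1.2.1 = (F t).1.2.1 + 1 := by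
    intro n
    induction n with
    | zero =>
      intro t ht
      refine ⟨?_, ?_⟩
      · have := (F t).2
        rw [ht] at this
        exact this
      · rw [Nat.add_zero, hF]; exact hz _ ht
    | succ n ih =>
      intro t ht
      obtain ⟨h1, h2⟩ := hs (F t) n ht
      rw [← hF] at h1 h2
      have := ih (t + 1) h2
      rw [h1] at this
      rw [show t + (n + 1) = t + 1 + n by omega]
      exact this
  have hle : ∀ t, (F t).1.2.1 ≤ t := by
    intro t
    induction t with
    | zero => simp [F, s0]
    | succ t ih =>
      rw [hF]
      rcases h : (F t).1.2.2 with _ | m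
      · rw [hz _ h]; omega
      · rw [(hs _ m h).1]; omega
  have hk : ∀ k, ∃ t, (F t).1.2.1 = k := by
    intro k
    induction k with
    | zero => exact ⟨0, rfl⟩
    | succ k ih =>
      obtain ⟨t, ht⟩ := ih
      exact ⟨_, by rw [(hit _ t rfl).2, ht]⟩
  refine ⟨fun n => (F n).1.1, rfl, fun n => by beta_reduce; rw [hF]; exact hR _, fun k => ?_⟩
  obtain ⟨t, ht⟩ := hk k
  refine ⟨t + (F t).1.2.2, ?_, ?_⟩
  · have := hle t; omega
  · have := (hit _ t rfl).1.1
    rw [ht] at this; exact this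

theorem inf_path {X ι : Type} [Countable ι] [Nonempty ι] (R : X → X → Prop) (Inv : X → Prop)
    (G : ι → X → Prop)
    (H : ∀ x, Inv x → ∀ k, ∃ y, Relation.TransGen R x y ∧ G k y ∧ Inv y) (x0 : X) (h0 : Inv x0) :
    ∃ f : ℕ → X, f 0 = x0 ∧ (∀ n, R (f n) (f (n + 1))) ∧
      ∀ i n, ∃ m, n ≤ m ∧ G i (f m) := by
  obtain ⟨e, he⟩ := exists_surjective_nat ι
  obtain ⟨f, h1, h2, h3⟩ := inf_path_nat R Inv (fun k => G (e k.unpair.1)) (fun x hx k => H x hx _)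
    x0 h0
  refine ⟨f, h1, h2, fun i n => ?_⟩
  obtain ⟨j, rfl⟩ := he i
  obtain ⟨m, hm, hg⟩ := h3 (Nat.pair j n)
  exact ⟨m, (Nat.right_le_pair j n).trans hm, by simpa using hg⟩

theorem inf_sc {X : Type} (r : ℕ → X) (R : X → X → Prop) (hR : ∀ n, R (r n) (r (n + 1)))
    [Finite X] {s t : X} (hs : s ∈ InfOcc r) (ht : t ∈ InfOcc r) :
    Relation.TransGen (fun x y => x ∈ InfOcc r ∧ R x y) s t := by
  obtain ⟨k, hk⟩ := infOcc_eventually r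
  obtain ⟨a, ha, rfl⟩ := hs k
  obtain ⟨b, hb, rfl⟩ := ht (a + 1)
  have : ∀ n, Relation.TransGen (fun x y => x ∈ InfOcc r ∧ R x y) (r a) (r (a + 1 + n)) := by
    intro n
    induction n with
    | zero => exact .single ⟨hk a ha, hR a⟩
    | succ n ih => exact ih.tail ⟨hk _ (by omega), hR _⟩
  have := this (b - (a + 1))
  rwa [show a + 1 + (b - (a + 1)) = b by omega] at this

/-! ### Positional determinacy -/

section Games

variable {V B : Type}

/-- Eve wins positionally. -/
def EveWins (Lose : Set V → Prop) (N : V → B → Set V) (v0 : V) : Prop :=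
  ∃ σ : V → B → V, (∀ v a, σ v a ∈ N v a) ∧ ∀ w, ¬ Lose (InfOcc (drun σ v0 w))

/-- The Adam strategy `(x0, o, u)` wins from `v0`. -/
def AdamStrat (Lose : Set V → Prop) (N : V → B → Set V) (v0 : V) {X : Type} (x0 : X)
    (o : X → B) (u : X → V → X) : Prop :=
  ∀ (π : ℕ → V) (ξ : ℕ → X), π 0 = v0 → ξ 0 = x0 →
    (∀ n, π (n + 1) ∈ N (π n) (o (ξ n)) ∧ ξ (n + 1) = u (ξ n) (π (n + 1))) → Lose (InfOcc π)

/-- Adam wins with some (infinite-memory) strategy. -/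
def AdamWins (Lose : Set V → Prop) (N : V → B → Set V) (v0 : V) : Prop :=
  ∃ (X : Type) (x0 : X) (o : X → B) (u : X → V → X), AdamStrat Lose N v0 x0 o u

theorem adam_proj {Lose : Set V → Prop} {N : V → B → Set V} {v : V} {X : Type} {x0 : X}
    {o : X → B} {u : X → V → X} (hA : AdamStrat Lose N v x0 o u)
    (π : ℕ → V) (ζ : ℕ → X) (s : ℕ → Prop) (h0 : π 0 = v) (hz : ζ 0 = x0)
    (hs : ∀ n, s n → π (n + 1) ∈ N (π n) (o (ζ n)) ∧ ζ (n + 1) = u (ζ n) (π (n + 1)))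
    (hns : ∀ n, ¬ s n → ζ (n + 1) = ζ n)
    (hch : ∀ n, ¬ (s n ↔ s (n + 1)) → π (n + 1) = v)
    (hinf : ∀ n, ∃ m, n ≤ m ∧ s m) :
    Lose {q | ∀ n, ∃ m, n ≤ m ∧ s m ∧ π m = q} := by
  classical
  have hI : (setOf s).Infinite := by
    rw [Set.infinite_iff_exists_gt]
    intro a
    obtain ⟨m, h1, h2⟩ := hinf (a + 1)
    exact ⟨m, h2, by omega⟩
  have hmem : ∀ n, s (Nat.nth s n) := fun n => Nat.nth_mem_of_infinite hI n
  have hmono : StrictMono (Nat.nth s) := Nat.nth_strictMono hI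
  have hfro : ∀ i j, (∀ k, j ≤ k → k < j + i → ¬ s k) → ζ (j + i) = ζ j := by
    intro i
    induction i with
    | zero => intro j _; rfl
    | succ i ih =>
      intro j h
      rw [← add_assoc, hns _ (h (j + i) (by omega) (by omega))]
      exact ih j (fun k h1 h2 => h k h1 (by omega))
  -- the key gap lemma
  have gap : ∀ j k, j ≤ k → (∀ i, j ≤ i → i < k → ¬ s i) → s k → (¬ s j → π j = v) →
      ζ k = ζ j ∧ π k = π j := by
    intro j k hjk hno hk hj
    refine ⟨?_, ?_⟩
    · have := hfro (k - j) j (fun i h1 h2 => hno i h1 (by omega))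
      rwa [show j + (k - j) = k by omega] at this
    · rcases Nat.eq_or_lt_of_le hjk with rfl | hlt
      · rfl
      · rw [hj (hno j le_rfl hlt)]
        obtain ⟨k', rfl⟩ : ∃ k', k = k' + 1 := ⟨k - 1, by omega⟩
        apply hch k'
        have := hno k' (by omega) (by omega)
        tauto
  have key := hA (fun n => π (Nat.nth s n)) (fun n => ζ (Nat.nth s n)) ?_ ?_ ?_
  · convert key using 1
    ext q
    constructor
    · intro h n
      obtain ⟨m, h1, h2, h3⟩ := h (Nat.nth s n)
      obtain ⟨i, rfl⟩ : ∃ i, Nat.nth s i = m := ⟨Nat.count s m, Nat.nth_count h2⟩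
      exact ⟨i, hmono.le_iff_le.1 h1, h3⟩
    · intro h n
      obtain ⟨m, h1, h2⟩ := h n
      exact ⟨Nat.nth s m, h1.trans (hmono.id_le m), hmem m, h2⟩
  · have := gap 0 (Nat.nth s 0) (Nat.zero_le _)
      (fun i _ hi hsi => by
        have := Nat.nth_count hsi
        rw [← this] at hi
        exact absurd (hmono.lt_iff_lt.1 hi) (by omega)) (hmem 0) (fun _ => h0)
    exact this.2.trans h0
  · have := gap 0 (Nat.nth s 0) (Nat.zero_le _)
      (fun i _ hi hsi => by
        have := Nat.nth_count hsi
        rw [← this] at hi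
        exact absurd (hmono.lt_iff_lt.1 hi) (by omega)) (hmem 0) (fun _ => h0)
    exact this.1.trans hz
  · intro n
    have hlt : Nat.nth s n < Nat.nth s (n + 1) := hmono (Nat.lt_succ_self n)
    have := gap (Nat.nth s n + 1) (Nat.nth s (n + 1)) hlt
      (fun i h1 hi hsi => by
        have := Nat.nth_count hsi
        rw [← this] at hi h1
        have a := hmono.lt_iff_lt.1 hi
        have b := hmono.lt_iff_lt.1 (Nat.lt_of_succ_le h1)
        omega) (hmem _) (fun hj => hch _ (by have := hmem n; tauto))
    beta_reduce
    rw [this.1, this.2]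
    exact hs _ (hmem n)

theorem adam_combine {Lose : Set V → Prop} (hL : ∀ S T, Lose S → Lose T → Lose (S ∪ T))
    {N N1 N2 : V → B → Set V} {v : V} {a : B} {e : V}
    (h1 : ∀ y b, ¬ (y = v ∧ b = a) → N y b = N1 y b)
    (h2 : ∀ y b, ¬ (y = v ∧ b = a) → N y b = N2 y b)
    (h1e : e ∈ N1 v a) (h2e : ∀ z ∈ N v a, z ≠ e → z ∈ N2 v a)
    (A1 : AdamWins Lose N1 v) (A2 : AdamWins Lose N2 v) : AdamWins Lose N v := by
  classical
  obtain ⟨X1, x1, o1, u1, A1⟩ := A1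
  obtain ⟨X2, x2, o2, u2, A2⟩ := A2
  -- memory: current vertex, two memories, side
  let side : V × X1 × X2 × Prop → V → Prop := fun x y' =>
    if x.1 = v then (o1 x.2.1 ≠ a ∨ (o2 x.2.2.1 = a ∧ y' = e)) else x.2.2.2
  let o : V × X1 × X2 × Prop → B := fun x =>
    if x.1 = v then (if o1 x.2.1 ≠ a then o1 x.2.1 else o2 x.2.2.1)
    else if x.2.2.2 then o1 x.2.1 else o2 x.2.2.1
  let u : V × X1 × X2 × Prop → V → V × X1 × X2 × Prop := fun x y' =>
    (y', if side x y' then u1 x.2.1 y' else x.2.1,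
      if side x y' then x.2.2.1 else u2 x.2.2.1 y', side x y')
  refine ⟨_, (v, x1, x2, True), o, u, ?_⟩
  intro π ξ hp hx hst
  have hcur : ∀ n, (ξ n).1 = π n := by
    intro n
    cases n with
    | zero => rw [hx, hp]
    | succ n => rw [(hst n).2]
  let s : ℕ → Prop := fun n => side (ξ n) (π (n + 1))
  have hb : ∀ n, (ξ (n + 1)).2.2.2 = s n := fun n => by rw [(hst n).2]
  have hch : ∀ n, ¬ (s n ↔ s (n + 1)) → π (n + 1) = v := by
    intro n h
    by_contra hv
    apply h
    have : s (n + 1) = (ξ (n + 1)).2.2.2 := by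
      simp only [s, side]
      rw [if_neg (by rw [hcur]; exact hv)]
    rw [this, hb]
  have hs1 : ∀ n, s n → π (n + 1) ∈ N1 (π n) (o1 (ξ n).2.1) ∧
      (ξ (n + 1)).2.1 = u1 (ξ n).2.1 (π (n + 1)) := by
    intro n hn
    refine ⟨?_, ?_⟩
    · have hm := (hst n).1
      have hn' := hn
      simp only [s, side, hcur] at hn'
      simp only [o, hcur] at hm
      by_cases hv : π n = v
      · simp only [hv, if_true] at hn' hm ⊢
        by_cases ho : o1 (ξ n).2.1 = a
        · rcases hn' with h | ⟨h, h'⟩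
          · exact absurd ho h
          · rw [ho, h']; exact h1e
        · rw [if_pos ho] at hm
          rwa [← h1 _ _ (by tauto)]
      · simp only [hv, if_false] at hn' hm
        rw [if_pos hn'] at hm
        rwa [← h1 _ _ (by tauto)]
    · rw [(hst n).2]; exact if_pos hn
  have hs2 : ∀ n, ¬ s n → π (n + 1) ∈ N2 (π n) (o2 (ξ n).2.2.1) ∧
      (ξ (n + 1)).2.2.1 = u2 (ξ n).2.2.1 (π (n + 1)) := by
    intro n hn
    refine ⟨?_, ?_⟩
    · have hm := (hst n).1
      have hn' := hn
      simp only [s, side, hcur] at hn'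
      simp only [o, hcur] at hm
      by_cases hv : π n = v
      · simp only [hv, if_true] at hn' hm ⊢
        by_cases ho : o1 (ξ n).2.1 = a
        · rw [if_neg (by tauto)] at hm
          by_cases ho2 : o2 (ξ n).2.2.1 = a
          · rw [ho2] at hm ⊢
            exact h2e _ hm (by tauto)
          · rwa [← h2 _ _ (by tauto)]
        · tauto
      · simp only [hv, if_false] at hn' hm
        rw [if_neg hn'] at hm
        rwa [← h2 _ _ (by tauto)]
    · rw [(hst n).2]; exact if_neg hn
  have hf1 : ∀ n, ¬ s n → (ξ (n + 1)).2.1 = (ξ n).2.1 := fun n hn => by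
    rw [(hst n).2]; exact if_neg hn
  have hf2 : ∀ n, ¬ ¬ s n → (ξ (n + 1)).2.2.1 = (ξ n).2.2.1 := fun n hn => by
    rw [(hst n).2]; exact if_pos (not_not.1 hn)
  have P1 := adam_proj A1 π (fun n => (ξ n).2.1) s hp (by rw [hx]) hs1 hf1 hch
  have P2 := adam_proj A2 π (fun n => (ξ n).2.2.1) (fun n => ¬ s n) hp (by rw [hx]) hs2 hf2
    (fun n h => hch n (by tauto))
  by_cases c1 : ∀ n, ∃ m, n ≤ m ∧ s m
  · by_cases c2 : ∀ n, ∃ m, n ≤ m ∧ ¬ s m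
    · have := hL _ _ (P1 c1) (P2 c2)
      convert this using 1
      ext q
      constructor
      · intro h
        by_contra hc
        simp only [Set.mem_union, Set.mem_setOf_eq, not_or] at hc
        obtain ⟨hc1, hc2⟩ := hc
        push Not at hc1 hc2
        obtain ⟨n1, hc1⟩ := hc1
        obtain ⟨n2, hc2⟩ := hc2
        obtain ⟨m, hm, e⟩ := h (n1 + n2)
        by_cases hsm : s m
        · exact hc1 m (by omega) hsm e
        · exact hc2 m (by omega) hsm e
      · rintro (h | h) n
        · obtain ⟨m, a, -, b⟩ := h n; exact ⟨m, a, b⟩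
        · obtain ⟨m, a, -, b⟩ := h n; exact ⟨m, a, b⟩
    · push Not at c2
      obtain ⟨n2, c2⟩ := c2
      convert P1 c1 using 1
      ext q
      constructor
      · intro h n
        obtain ⟨m, hm, e⟩ := h (n + n2)
        exact ⟨m, by omega, c2 m (by omega), e⟩
      · intro h n
        obtain ⟨m, a, -, b⟩ := h n; exact ⟨m, a, b⟩
  · push Not at c1
    obtain ⟨n2, c1⟩ := c1
    convert P2 (fun n => ⟨n + n2, by omega, c1 _ (by omega)⟩) using 1
    ext q
    constructor
    · intro h n
      obtain ⟨m, hm, e⟩ := h (n + n2)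
      exact ⟨m, by omega, c1 m (by omega), e⟩
    · intro h n
      obtain ⟨m, a, -, b⟩ := h n; exact ⟨m, a, b⟩

theorem adam_reach {Lose : Set V → Prop} {N N1 : V → B → Set V} {v v0 : V}
    (h1 : ∀ y b, y ≠ v → N y b = N1 y b)
    (A1 : AdamWins Lose N1 v0) (E1 : EveWins Lose N1 v) : AdamWins Lose N v0 := by
  classical
  obtain ⟨X, x0, o, u, A1⟩ := A1
  obtain ⟨σ, hσ, hw⟩ := E1
  refine ⟨X, x0, o, u, fun π ξ hp hx hst => ?_⟩
  by_cases hv : ∃ k, π k = v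
  · exfalso
    let k := Nat.find hv
    have hk : π k = v := Nat.find_spec hv
    have hlt : ∀ n, n < k → π n ≠ v := fun n hn => Nat.find_min hv hn
    let st : V × X → V × X := fun p => (σ p.1 (o p.2), u p.2 (σ p.1 (o p.2)))
    let τ : ℕ → V × X := fun n => st^[n] (v, ξ k)
    have hτ : ∀ n, τ (n + 1) = st (τ n) := fun n => Function.iterate_succ_apply' st n _
    let π' : ℕ → V := fun n => if n < k then π n else (τ (n - k)).1
    let ξ' : ℕ → X := fun n => if n < k then ξ n else (τ (n - k)).2
    have e1 : ∀ n, n ≤ k → π' n = π n ∧ ξ' n = ξ n := by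
      intro n hn
      rcases Nat.lt_or_eq_of_le hn with h | rfl
      · simp [π', ξ', h]
      · simp [π', ξ', τ, hk]
    have e2 : ∀ n, π' (n + k) = (τ n).1 ∧ ξ' (n + k) = (τ n).2 := by
      intro n; simp [π', ξ']
    have L := A1 π' ξ' ((e1 0 (Nat.zero_le _)).1.trans hp) ((e1 0 (Nat.zero_le _)).2.trans hx) (by
      intro n
      rcases Nat.lt_or_ge n k with h | h
      · rw [(e1 n h.le).1, (e1 n h.le).2, (e1 (n + 1) h).1, (e1 (n + 1) h).2,
          ← h1 _ _ (hlt n h)]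
        exact hst n
      · obtain ⟨j, rfl⟩ : ∃ j, n = j + k := ⟨n - k, by omega⟩
        rw [show j + k + 1 = (j + 1) + k by omega, (e2 j).1, (e2 j).2, (e2 (j + 1)).1,
          (e2 (j + 1)).2, hτ]
        exact ⟨hσ _ _, rfl⟩)
    apply hw (fun n => o (τ n).2)
    have e3 : drun σ v (fun n => o (τ n).2) = fun n => π' (n + k) := by
      funext n
      rw [(e2 n).1]
      induction n with
      | zero => rfl
      | succ n ih => simp only [drun]; rw [ih, hτ]
    rw [e3, infOcc_shift]
    exact L
  · push Not at hv
    exact A1 π ξ hp hx (fun n => by rw [← h1 _ _ (hv n)]; exact hst n)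

theorem adam_switch {Lose : Set V → Prop} {N N1 : V → B → Set V} {v v0 : V}
    (h1 : ∀ y b, y ≠ v → N y b = N1 y b)
    (A1 : AdamWins Lose N1 v0) (A2 : AdamWins Lose N v) : AdamWins Lose N v0 := by
  classical
  by_cases hv0 : v0 = v
  · rw [hv0]; exact A2
  obtain ⟨X, x0, o, u, A1⟩ := A1
  obtain ⟨X2, y0, o2, u2, A2⟩ := A2
  let U : X ⊕ X2 → V → X ⊕ X2 := fun x y =>
    match x with
    | Sum.inl x => if y = v then Sum.inr y0 else Sum.inl (u x y)
    | Sum.inr x => Sum.inr (u2 x y)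
  refine ⟨X ⊕ X2, Sum.inl x0, Sum.elim o o2, U, fun π ξ hp hx hst => ?_⟩
  by_cases hv : ∃ k, π k = v
  · let k := Nat.find hv
    have hk : π k = v := Nat.find_spec hv
    have hlt : ∀ n, n < k → π n ≠ v := fun n hn => Nat.find_min hv hn
    have hk0 : k ≠ 0 := by
      intro h; rw [h, hp] at hk; exact hv0 hk
    have hl : ∀ n, n < k → ∃ x, ξ n = Sum.inl x := by
      intro n
      induction n with
      | zero => intro _; exact ⟨x0, hx⟩
      | succ n ih =>
        intro h
        obtain ⟨x, hx⟩ := ih (by omega)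
        refine ⟨u x (π (n + 1)), ?_⟩
        rw [(hst n).2, hx]
        simp only [U]
        rw [if_neg (hlt _ h)]
    have hk' : ξ k = Sum.inr y0 := by
      obtain ⟨j, hj⟩ : ∃ j, k = j + 1 := ⟨k - 1, by omega⟩
      obtain ⟨x, hx⟩ := hl j (by omega)
      rw [hj] at hk ⊢
      rw [(hst j).2, hx]
      simp only [U]
      rw [if_pos hk]
    have hr : ∀ n, ∃ x, ξ (n + k) = Sum.inr x := by
      intro n
      induction n with
      | zero => exact ⟨y0, by rw [Nat.zero_add]; exact hk'⟩
      | succ n ih =>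
        obtain ⟨x, hx⟩ := ih
        refine ⟨u2 x (π (n + k + 1)), ?_⟩
        rw [show n + 1 + k = n + k + 1 by omega, (hst _).2, hx]
    choose ζ hζ using hr
    rw [← infOcc_shift π k]
    refine A2 _ ζ (by simpa using hk) ?_ ?_
    · have := hζ 0
      rw [Nat.zero_add, hk'] at this
      exact (Sum.inr.inj this).symm
    · intro n
      have := hst (n + k)
      rw [show n + k + 1 = n + 1 + k by omega, hζ, hζ] at this
      exact ⟨this.1, Sum.inr.inj this.2⟩
  · push Not at hv
    have hl : ∀ n, ∃ x, ξ n = Sum.inl x := by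
      intro n
      induction n with
      | zero => exact ⟨x0, hx⟩
      | succ n ih =>
        obtain ⟨x, hx⟩ := ih
        refine ⟨u x (π (n + 1)), ?_⟩
        rw [(hst n).2, hx]
        simp only [U]
        rw [if_neg (hv _)]
    choose ζ hζ using hl
    refine A1 π ζ hp ?_ ?_
    · have := hζ 0
      rw [hx] at this
      exact (Sum.inl.inj this).symm
    · intro n
      have := hst n
      rw [hζ, hζ] at this
      simp only [U] at this
      rw [if_neg (hv _)] at this
      rw [← h1 _ _ (hv n)]
      exact ⟨this.1, Sum.inl.inj this.2⟩

theorem determinacy [Finite V] [Finite B] {Lose : Set V → Prop}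
    (hL : ∀ S T, Lose S → Lose T → Lose (S ∪ T)) (n : ℕ) :
    ∀ (N : V → B → Set V), (∀ v a, (N v a).Nonempty) →
      {t : V × B × V | t.2.2 ∈ N t.1 t.2.1}.ncard = n →
      ∀ v0, EveWins Lose N v0 ∨ AdamWins Lose N v0 := by
  classical
  induction n using Nat.strong_induction_on with
  | _ n ih =>
  intro N hN hn v0
  by_cases hsub : ∀ v a, (N v a).Subsingleton
  · choose σ hσ using hN
    by_cases hw : ∀ w, ¬ Lose (InfOcc (drun σ v0 w))
    · exact Or.inl ⟨σ, hσ, hw⟩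
    · push Not at hw
      obtain ⟨w, hw⟩ := hw
      refine Or.inr ⟨ℕ, 0, w, fun n _ => n + 1, fun π ξ hp hx hst => ?_⟩
      have e1 : ∀ n, ξ n = n := by
        intro n
        induction n with
        | zero => exact hx
        | succ n ih => rw [(hst n).2, ih]
      have e2 : π = drun σ v0 w := by
        funext n
        induction n with
        | zero => exact hp
        | succ n ih =>
          have := (hst n).1
          rw [e1] at this
          simp only [drun]
          rw [← ih]
          exact hsub _ _ this (hσ _ _)
      rw [e2]; exact hw
  · push Not at hsub
    obtain ⟨v, a, hva⟩ := hsub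
    obtain ⟨e, he, e', he', hne⟩ := Set.not_subsingleton_iff.1 (by simpa using hva)
    let N1 : V → B → Set V := fun y b => if y = v ∧ b = a then {e} else N y b
    let N2 : V → B → Set V := fun y b => if y = v ∧ b = a then N v a \ {e} else N y b
    have hN1 : ∀ y b, ¬ (y = v ∧ b = a) → N y b = N1 y b := fun y b h => by simp [N1, h]
    have hN2 : ∀ y b, ¬ (y = v ∧ b = a) → N y b = N2 y b := fun y b h => by simp [N2, h]
    have s1 : ∀ y b, N1 y b ⊆ N y b := by
      intro y b
      by_cases h : y = v ∧ b = a
      · simp only [N1]; rw [if_pos h, h.1, h.2]; simpa using he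
      · rw [hN1 _ _ h]
    have s2 : ∀ y b, N2 y b ⊆ N y b := by
      intro y b
      by_cases h : y = v ∧ b = a
      · simp only [N2]; rw [if_pos h, h.1, h.2]; exact Set.diff_subset
      · rw [hN2 _ _ h]
    have t1 : ∀ y b, (N1 y b).Nonempty := by
      intro y b
      by_cases h : y = v ∧ b = a
      · simp only [N1]; rw [if_pos h]; exact ⟨e, rfl⟩
      · rw [← hN1 _ _ h]; exact hN _ _
    have t2 : ∀ y b, (N2 y b).Nonempty := by
      intro y b
      by_cases h : y = v ∧ b = a
      · simp only [N2]; rw [if_pos h]; exact ⟨e', he', by simpa using hne.symm⟩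
      · rw [← hN2 _ _ h]; exact hN _ _
    have c1 : {t : V × B × V | t.2.2 ∈ N1 t.1 t.2.1}.ncard < n := by
      rw [← hn]
      refine Set.ncard_lt_ncard ⟨fun t ht => s1 _ _ ht, fun h => ?_⟩ (Set.toFinite _)
      have : e' ∈ N1 v a := h (show (v, a, e') ∈ {t : V × B × V | t.2.2 ∈ N t.1 t.2.1} from he')
      simp [N1] at this
      exact hne this.symm
    have c2 : {t : V × B × V | t.2.2 ∈ N2 t.1 t.2.1}.ncard < n := by
      rw [← hn]
      refine Set.ncard_lt_ncard ⟨fun t ht => s2 _ _ ht, fun h => ?_⟩ (Set.toFinite _)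
      have : e ∈ N2 v a := h (show (v, a, e) ∈ {t : V × B × V | t.2.2 ∈ N t.1 t.2.1} from he)
      simp [N2] at this
    have I1 := ih _ c1 N1 t1 rfl
    have I2 := ih _ c2 N2 t2 rfl
    rcases I1 v0 with ⟨σ, h, h'⟩ | A1
    · exact Or.inl ⟨σ, fun y b => s1 _ _ (h y b), h'⟩
    rcases I2 v0 with ⟨σ, h, h'⟩ | A2
    · exact Or.inl ⟨σ, fun y b => s2 _ _ (h y b), h'⟩
    right
    rcases I1 v with E1 | B1
    · exact adam_reach (fun y b h => hN1 y b (by tauto)) A1 E1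
    rcases I2 v with E2 | B2
    · exact adam_reach (fun y b h => hN2 y b (by tauto)) A2 E2
    refine adam_switch (fun y b h => hN1 y b (by tauto)) A1 ?_
    refine adam_combine hL hN1 hN2 (e := e) (by simp [N1]) ?_ B1 B2
    intro z hz hze
    simp [N2, hz, hze]

end Games

/-! ### Finite memory strategies -/

/-- The language from a state. -/
def LM (M : Auto A Q) (acc : Set Q → Prop) (q : Q) : Set (ℕ → A) :=
  {w | ∃ r : ℕ → Q, r 0 = q ∧ (∀ i, r (i + 1) ∈ M.next (r i) (w i)) ∧ acc (InfOcc r)}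

/-- Deterministic Büchi acceptance. -/
def DAcc {D : Type} (δ : D → A → D) (β : Set D) (d : D) (w : ℕ → A) : Prop :=
  ∀ n, ∃ k, n ≤ k ∧ drun δ d w k ∈ β

theorem drun_cons {X B : Type} (f : X → B → X) (x : X) (a : B) (w : ℕ → B) (n : ℕ) :
    drun f x (consW a w) (n + 1) = drun f (f x a) w n :=
  drun_shift f x (consW a w) 1 n

theorem dacc_shift {D : Type} (δ : D → A → D) (β : Set D) (d : D) (w : ℕ → A) (k : ℕ) :
    DAcc δ β (drun δ d w k) (fun n => w (n + k)) ↔ DAcc δ β d w := by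
  constructor
  · intro h n
    obtain ⟨j, hj, e⟩ := h n
    exact ⟨j + k, by omega, by rwa [drun_shift]⟩
  · intro h n
    obtain ⟨j, hj, e⟩ := h (n + k)
    refine ⟨j - k, by omega, ?_⟩
    rw [← drun_shift, Nat.sub_add_cancel (by omega)]; exact e

theorem dacc_cons {D : Type} (δ : D → A → D) (β : Set D) (d : D) (a : A) (w : ℕ → A) :
    DAcc δ β (δ d a) w ↔ DAcc δ β d (consW a w) :=
  dacc_shift δ β d (consW a w) 1

theorem lm_cons {M : Auto A Q} {ι : Type} {E F : ι → Set Q} {q q' : Q} {a : A}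
    (h : q' ∈ M.next q a) {w : ℕ → A} (hw : w ∈ LM M (RabinAcc E F) q') :
    consW a w ∈ LM M (RabinAcc E F) q := by
  obtain ⟨r, h0, h1, h2⟩ := hw
  refine ⟨consW q r, rfl, ?_, ?_⟩
  · intro i
    cases i with
    | zero => show r 0 ∈ M.next q a; rw [h0]; exact h
    | succ i => exact h1 i
  · rw [← infOcc_shift (consW q r) 1]; exact h2

/-- A good transducer. -/
structure GoodT {D Mem : Type} {ι : Type} (M : Auto A Q) (E F : ι → Set Q) (δ : D → A → D)
    (β : Set D) (upd : Mem → A → Mem) (out : Mem → Q) : Prop where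
  step : ∀ m a, out (upd m a) ∈ M.next (out m) a
  good : ∀ m w, w ∈ LM M (RabinAcc E F) (out m) → RabinAcc E F (InfOcc (fun n => out (drun upd m w n)))
  dres : ∀ m, ∃ d, ∀ w, DAcc δ β d w ↔ w ∈ LM M (RabinAcc E F) (out m)

theorem GoodT.res {D Mem : Type} {ι : Type} {M : Auto A Q} {E F : ι → Set Q} {δ : D → A → D}
    {β : Set D} {upd : Mem → A → Mem} {out : Mem → Q} (h : GoodT M E F δ β upd out) (m : Mem) (a : A)
    (w : ℕ → A) : consW a w ∈ LM M (RabinAcc E F) (out m) ↔ w ∈ LM M (RabinAcc E F) (out (upd m a)) := by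
  refine ⟨fun hw => ?_, lm_cons (h.step m a)⟩
  have := h.good m _ hw
  rw [← infOcc_shift _ 1] at this
  simp only [drun_cons] at this
  exact ⟨_, rfl, fun i => h.step _ _, this⟩

theorem prefixWord_getD (u : List A) (a b : A) :
    prefixWord (fun n => (u ++ [a]).getD n b) u.length = u := by
  apply List.ext_getElem
  · simp [prefixWord]
  · intro i h1 h2
    simp [prefixWord, List.getD, List.getElem?_append_left h2, List.getElem?_eq_getElem h2]

theorem exists_goodT [Finite A] [Finite Q] {D ι : Type} [Finite D] (M : Auto A Q) (E F : ι → Set Q)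
    (δ : D → A → D) (β : Set D) (d0 : D)
    (hD : ∀ w, DAcc δ β d0 w ↔ w ∈ M.Lang (RabinAcc E F)) (g : List A → Q)
    (hg : IsGFGStrategy M (RabinAcc E F) g) :
    ∃ (Mem : Type) (_ : Finite Mem) (upd : Mem → A → Mem) (out : Mem → Q) (m0 : Mem),
      GoodT M E F δ β upd out ∧ LM M (RabinAcc E F) (out m0) = M.Lang (RabinAcc E F) := by
  classical
  have hstep : ∀ u a, g (u ++ [a]) ∈ M.next (g u) a := by
    intro u a
    have := ((hg (fun n => (u ++ [a]).getD n a)).1).2 u.length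
    simp only [StrategyRun, prefixWord_succ, prefixWord_getD] at this
    simpa using this
  let Q1 := {q : Q // ∃ u, g u = q}
  let V := D × Q1
  let N : V → A → Set V := fun v a => {v' | v'.1 = δ v.1 a ∧ v'.2.1 ∈ M.next v.2.1 a}
  let pr : V → Q := fun v => v.2.1
  let Lose : Set V → Prop := fun S => (∃ s ∈ S, s.1 ∈ β) ∧ ¬ RabinAcc E F (pr '' S)
  have hL : ∀ S T, Lose S → Lose T → Lose (S ∪ T) := by
    rintro S T ⟨⟨s, hs, hb⟩, h1⟩ ⟨-, h2⟩
    refine ⟨⟨s, Or.inl hs, hb⟩, ?_⟩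
    rw [Set.image_union]
    intro h
    rcases rabin_union E F _ _ h with h | h
    · exact h1 h
    · exact h2 h
  have hN : ∀ v a, (N v a).Nonempty := by
    rintro ⟨d, q, u, rfl⟩ a
    exact ⟨(δ d a, ⟨g (u ++ [a]), _, rfl⟩), rfl, hstep u a⟩
  let v0 : V := (d0, ⟨g [], _, rfl⟩)
  have hdet := determinacy hL _ N hN rfl v0
  have hnotadam : ¬ AdamWins Lose N v0 := by
    rintro ⟨X, x0, o, u, hA⟩
    let s : ℕ → List A × D × X := fun n => Nat.rec ([], d0, x0)
      (fun _ p => (p.1 ++ [o p.2.2], δ p.2.1 (o p.2.2),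
        u p.2.2 (δ p.2.1 (o p.2.2), ⟨g (p.1 ++ [o p.2.2]), _, rfl⟩))) n
    let w : ℕ → A := fun n => o (s n).2.2
    let π : ℕ → V := fun n => ((s n).2.1, ⟨g (s n).1, _, rfl⟩)
    have hlose := hA π (fun n => (s n).2.2) rfl rfl (fun n => ⟨⟨rfl, hstep _ _⟩, rfl⟩)
    have hp : ∀ n, prefixWord w n = (s n).1 := by
      intro n
      induction n with
      | zero => rfl
      | succ n ih => rw [prefixWord_succ, ih]
    have hd : ∀ n, drun δ d0 w n = (s n).2.1 := by
      intro n
      induction n with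
      | zero => rfl
      | succ n ih => simp only [drun]; rw [ih]
    obtain ⟨⟨v, hv, hvb⟩, hrej⟩ := hlose
    have hw : w ∈ M.Lang (RabinAcc E F) := by
      rw [← hD]
      intro n
      obtain ⟨k, hk, e⟩ := hv n
      refine ⟨k, hk, ?_⟩
      rw [hd]
      have : (s k).2.1 = v.1 := by rw [← e]
      rwa [this]
    have := (hg w).2 hw
    apply hrej
    rw [← infOcc_comp]
    convert this using 3 with n
    simp only [pr, π, StrategyRun, hp]
  obtain ⟨σ, hσ, hwin⟩ := hdet.resolve_right hnotadam
  let Inv : V → Prop := fun v => (∀ w, ¬ Lose (InfOcc (drun σ v w))) ∧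
    ∀ w ∈ LM M (RabinAcc E F) v.2.1, DAcc δ β v.1 w
  have h1 : ∀ v w n, (drun σ v w n).1 = drun δ v.1 w n := by
    intro v w n
    induction n with
    | zero => rfl
    | succ n ih => simp only [drun]; rw [← ih]; exact (hσ _ _).1
  have h2 : ∀ v w, Inv v → DAcc δ β v.1 w → RabinAcc E F (InfOcc (fun n => pr (drun σ v w n))) := by
    intro v w hv hd
    have := hv.1 w
    by_contra hc
    apply this
    refine ⟨?_, by rwa [← infOcc_comp]⟩
    obtain ⟨x, hx⟩ := infOcc_pigeon (drun σ v w) (fun n => (drun σ v w n).1 ∈ β) (by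
      intro n; obtain ⟨k, hk, e⟩ := hd n; exact ⟨k, hk, by rwa [h1]⟩)
    obtain ⟨m, -, hb, e⟩ := hx 0
    exact ⟨x, fun n => by obtain ⟨m, a, -, b⟩ := hx n; exact ⟨m, a, b⟩, e ▸ hb⟩
  have h3 : ∀ v w, Inv v → DAcc δ β v.1 w → w ∈ LM M (RabinAcc E F) v.2.1 := by
    intro v w hv hd
    exact ⟨_, rfl, fun i => (hσ _ _).2, h2 v w hv hd⟩
  have hInv : ∀ v a, Inv v → Inv (σ v a) := by
    intro v a hv
    constructor
    · intro w
      have := hv.1 (consW a w)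
      rw [← infOcc_shift _ 1] at this
      simpa only [drun_cons] using this
    · intro w hw
      have := hv.2 _ (lm_cons (hσ v a).2 hw)
      rw [← dacc_cons] at this
      rwa [(hσ v a).1]
  have hI0 : Inv v0 := by
    refine ⟨hwin, ?_⟩
    rintro w ⟨r, e, hr, hacc⟩
    refine (hD w).2 ⟨r, ⟨?_, hr⟩, hacc⟩
    rw [e]
    exact (hg w).1.1
  let upd : {v // Inv v} → A → {v // Inv v} := fun v a => ⟨σ v.1 a, hInv _ a v.2⟩
  have h4 : ∀ v w n, (drun upd v w n).1 = drun σ v.1 w n := by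
    intro v w n
    induction n with
    | zero => rfl
    | succ n ih => simp only [drun]; rw [← ih]
  refine ⟨{v // Inv v}, inferInstance, upd, fun v => v.1.2.1, ⟨v0, hI0⟩, ⟨?_, ?_, ?_⟩, ?_⟩
  · intro m a
    exact (hσ m.1 a).2
  · intro m w hw
    have := h2 m.1 w m.2 (m.2.2 w hw)
    simpa only [h4] using this
  · intro m
    exact ⟨m.1.1, fun w => ⟨h3 _ _ m.2, m.2.2 w⟩⟩
  · ext w
    rw [← hD]
    exact ⟨hI0.2 w, h3 _ _ hI0⟩
/-! ### Tight strategies -/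

open Relation in
/-- Tightness of a transducer. -/
def TightT {Mem : Type} {ι : Type} (E F : ι → Set Q) (upd : Mem → A → Mem) (out : Mem → Q) : Prop :=
  ∀ x x', out x = out x' → ∃ R : Set Q, ¬ RabinAcc E F R ∧
    ReflTransGen (fun y z => out y ∈ R ∧ ∃ a, z = upd y a) x' x ∧
    ∀ s ∈ R, ∃ y, out y = s ∧ ReflTransGen (fun y z => out y ∈ R ∧ ∃ a, z = upd y a) x' y ∧
      ReflTransGen (fun y z => out y ∈ R ∧ ∃ a, z = upd y a) y x

theorem GoodT.tail {D Mem : Type} {ι : Type} {M : Auto A Q} {E F : ι → Set Q} {δ : D → A → D}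
    {β : Set D} {upd : Mem → A → Mem} {out : Mem → Q} (h : GoodT M E F δ β upd out) (m : Mem)
    (w : ℕ → A) (hw : w ∈ LM M (RabinAcc E F) (out m)) (k : ℕ) :
    (fun i => w (i + k)) ∈ LM M (RabinAcc E F) (out (drun upd m w k)) := by
  induction k with
  | zero => exact hw
  | succ k ih =>
    simp only [drun]
    rw [← h.res]
    convert ih using 1
    funext n
    cases n with
    | zero => simp [consW]
    | succ n => simp only [consW]; congr 1; omega

open Relation in
theorem exists_tight [Finite Q] {D ι : Type} (M : Auto A Q) (E F : ι → Set Q)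
    (δ : D → A → D) (β : Set D) (L : Set (ℕ → A))
    (hex : ∃ (Mem : Type) (_ : Finite Mem) (upd : Mem → A → Mem) (out : Mem → Q) (m0 : Mem),
      GoodT M E F δ β upd out ∧ LM M (RabinAcc E F) (out m0) = L) :
    ∃ (Mem : Type) (_ : Finite Mem) (upd : Mem → A → Mem) (out : Mem → Q) (m0 : Mem),
      GoodT M E F δ β upd out ∧ LM M (RabinAcc E F) (out m0) = L ∧ TightT E F upd out := by
  classical
  let P : ℕ → Prop := fun n => ∃ (Mem : Type) (_ : Finite Mem) (upd : Mem → A → Mem) (out : Mem → Q) (m0 : Mem),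
      GoodT M E F δ β upd out ∧ LM M (RabinAcc E F) (out m0) = L ∧ Nat.card Mem = n
  have hP : ∃ n, P n := by
    obtain ⟨Mem, i, upd, out, m0, h1, h2⟩ := hex
    exact ⟨_, Mem, i, upd, out, m0, h1, h2, rfl⟩
  obtain ⟨Mem, hfin, upd, out, m0, hG, hL, hcard⟩ := Nat.find_spec hP
  refine ⟨Mem, hfin, upd, out, m0, hG, hL, ?_⟩
  intro m m' hmm
  by_cases hne : m = m'
  · subst hne
    refine ⟨∅, ?_, ReflTransGen.refl, by simp⟩
    rintro ⟨i, -, h⟩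
    simp at h
  let red : Mem → Mem := fun x => if x = m then m' else x
  have hred : ∀ x, red x ≠ m := by
    intro x; simp only [red]; split_ifs with h
    · exact fun h => hne h.symm
    · exact h
  have hout : ∀ x, out (red x) = out x := by
    intro x; simp only [red]; split_ifs with h
    · rw [h, hmm]
    · rfl
  let Mem' := {x : Mem // x ≠ m}
  let upd' : Mem' → A → Mem' := fun x a => ⟨red (upd x.1 a), hred _⟩
  have hnotgood : ¬ ∀ x w, w ∈ LM M (RabinAcc E F) (out x.1) →
      RabinAcc E F (InfOcc (fun n => out (drun upd' x w n).1)) := by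
    intro hgood
    have hlt : Nat.card Mem' < Nat.find hP := by
      rw [← hcard]
      cases nonempty_fintype Mem
      rw [Nat.card_eq_fintype_card, Nat.card_eq_fintype_card]
      exact Fintype.card_subtype_lt (x := m) (by simp)
    apply Nat.find_min hP hlt
    refine ⟨Mem', inferInstance, upd', fun x => out x.1, ⟨red m0, hred _⟩, ⟨?_, hgood, ?_⟩, ?_, rfl⟩
    · intro x a
      show out (red _) ∈ _
      rw [hout]; exact hG.step _ _
    · intro x; exact hG.dres x.1
    · show LM M _ (out (red m0)) = L
      rw [hout]; exact hL
  push Not at hnotgood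
  obtain ⟨x0, w, hw, hrej⟩ := hnotgood
  let r : ℕ → Mem := fun n => (drun upd' x0 w n).1
  have hr : ∀ n, r (n + 1) = red (upd (r n) (w n)) := fun n => rfl
  have htail : ∀ k, (fun i => w (i + k)) ∈ LM M (RabinAcc E F) (out (r k)) := by
    intro k
    induction k with
    | zero => exact hw
    | succ k ih =>
      rw [hr, hout, ← hG.res]
      convert ih using 1
      funext n
      cases n with
      | zero => simp [consW]
      | succ n => simp only [consW]; congr 1; omega
  have hinf : ∀ k, ∃ n, k ≤ n ∧ upd (r n) (w n) = m := by
    by_contra hc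
    push Not at hc
    obtain ⟨k, hk⟩ := hc
    have : ∀ n, r (n + k) = drun upd (r k) (fun i => w (i + k)) n := by
      intro n
      induction n with
      | zero => simp [drun]
      | succ n ih =>
        rw [Nat.add_right_comm, hr]
        simp only [drun]
        rw [← ih]
        simp only [red]
        rw [if_neg (hk _ (by omega))]
    have h2 := hG.good _ _ (htail k)
    simp only [← this] at h2
    rw [infOcc_shift (fun n => out (r n)) k] at h2
    exact hrej h2
  refine ⟨InfOcc (fun n => out (r n)), hrej, ?_⟩
  obtain ⟨k, hk⟩ := infOcc_eventually (fun n => out (r n))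
  obtain ⟨n0, hn0, e0⟩ := hinf k
  have hto : ∀ t, ReflTransGen (fun y z => out y ∈ InfOcc (fun n => out (r n)) ∧ ∃ a, z = upd y a) m'
      (r (n0 + 1 + t)) := by
    intro t
    induction t with
    | zero => simp only [Nat.add_zero, hr, e0, red, if_true]; exact ReflTransGen.refl
    | succ t ih =>
      rw [← Nat.add_assoc, hr]
      simp only [red]
      split_ifs with h
      · exact ReflTransGen.refl
      · exact ih.tail ⟨hk _ (by omega), _, rfl⟩
  have hfrom : ∀ j t, k ≤ t → upd (r (t + j)) (w (t + j)) = m →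
      ReflTransGen (fun y z => out y ∈ InfOcc (fun n => out (r n)) ∧ ∃ a, z = upd y a) (r t) m := by
    intro j
    induction j with
    | zero =>
      intro t ht e
      exact ReflTransGen.single ⟨hk _ ht, _, e.symm⟩
    | succ j ih =>
      intro t ht e
      by_cases h : upd (r t) (w t) = m
      · exact ReflTransGen.single ⟨hk _ ht, _, h.symm⟩
      · refine ReflTransGen.head (b := r (t + 1)) ⟨hk _ ht, w t, ?_⟩ (ih (t + 1) (by omega) ?_)
        · rw [hr]; simp only [red]; rw [if_neg h]
        · rw [Nat.add_right_comm, Nat.add_assoc]; exact e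
  have hfrom' : ∀ t, k ≤ t →
      ReflTransGen (fun y z => out y ∈ InfOcc (fun n => out (r n)) ∧ ∃ a, z = upd y a) (r t) m := by
    intro t ht
    obtain ⟨n, hn, e⟩ := hinf t
    obtain ⟨j, rfl⟩ := Nat.exists_eq_add_of_le hn
    exact hfrom j t ht e
  refine ⟨(hto 0).trans (hfrom' _ (by omega)), ?_⟩
  intro s hs
  obtain ⟨t, ht, e⟩ := hs (n0 + 1)
  obtain ⟨j, rfl⟩ := Nat.exists_eq_add_of_le ht
  exact ⟨_, e, hto j, hfrom' _ (by omega)⟩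

/-- Transitions used by the transducer. -/
def N0 {Mem : Type} (upd : Mem → A → Mem) (out : Mem → Q) (q : Q) (a : A) (q' : Q) : Prop :=
  ∃ m, out m = q ∧ out (upd m a) = q'

/-- Sound states. -/
def Sound {Mem : Type} (L : Q → Set (ℕ → A)) (upd : Mem → A → Mem) (out : Mem → Q) (q : Q) : Prop :=
  ∀ (ρ : ℕ → Q) (w : ℕ → A), (∀ n, N0 upd out (ρ n) (w n) (ρ (n + 1))) →
    (∀ n, ∃ k, n ≤ k ∧ ρ k = q) → w ∈ L (ρ 0)

open Relation in
theorem sound_inf [Finite Q] {D Mem ι : Type} [Finite Mem] {M : Auto A Q} {E F : ι → Set Q}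
    {δ : D → A → D} {β : Set D} {upd : Mem → A → Mem} {out : Mem → Q}
    (hG : GoodT M E F δ β upd out) (hT : TightT E F upd out) (m : Mem) (w : ℕ → A)
    (hw : w ∈ LM M (RabinAcc E F) (out m)) :
    ∀ n, ∃ k, n ≤ k ∧ Sound (LM M (RabinAcc E F)) upd out (out (drun upd m w k)) := by
  classical
  by_contra hc
  push Not at hc
  obtain ⟨n0, hn0⟩ := hc
  set r := drun upd m w with hr
  have hI : ∀ x : InfOcc r, ¬ Sound (LM M (RabinAcc E F)) upd out (out x.1) := by
    rintro ⟨x, hx⟩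
    obtain ⟨k, hk, e⟩ := hx n0
    have := hn0 k hk
    rwa [e] at this
  unfold Sound at hI
  push Not at hI
  choose ρ ws hρ hinf hrej using hI
  have hN0 : ∀ q a q', N0 upd out q a q' → q' ∈ M.next q a := by
    rintro q a q' ⟨x, rfl, rfl⟩
    exact hG.step _ _
  let Z : Set Q := ⋃ x : InfOcc r, InfOcc (ρ x)
  have hZrej : ¬ RabinAcc E F Z := by
    intro h
    obtain ⟨x, hx⟩ := rabin_iUnion E F _ h
    exact hrej x ⟨ρ x, rfl, fun i => hN0 _ _ _ (hρ x i), hx⟩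
  have hIZ : ∀ x ∈ InfOcc r, out x ∈ Z := fun x hx =>
    Set.mem_iUnion.2 ⟨⟨x, hx⟩, hinf ⟨x, hx⟩⟩
  let stepZ : Q → Q → Prop := fun s t => s ∈ Z ∧ ∃ a, N0 upd out s a t
  have hsc1 : ∀ x : InfOcc r, ∀ s ∈ InfOcc (ρ x), ∀ t ∈ InfOcc (ρ x), TransGen stepZ s t := by
    intro x s hs t ht
    refine TransGen.mono ?_ _ _ (inf_sc (ρ x) (fun s t => ∃ a, N0 upd out s a t) (fun n => ⟨_, hρ x n⟩) hs ht)
    rintro a b ⟨h1, h2⟩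
    exact ⟨Set.mem_iUnion.2 ⟨x, h1⟩, h2⟩
  have hsc2 : ∀ x ∈ InfOcc r, ∀ y ∈ InfOcc r, TransGen stepZ (out x) (out y) := by
    intro x hx y hy
    refine TransGen.lift out ?_ _ _ (inf_sc r (fun s t => ∃ a, t = upd s a) (fun n => ⟨w n, rfl⟩) hx hy)
    rintro a b ⟨h1, c, rfl⟩
    exact ⟨hIZ _ h1, c, a, rfl, rfl⟩
  have hsc : ∀ s ∈ Z, ∀ t ∈ Z, TransGen stepZ s t := by
    intro s hs t ht
    obtain ⟨x, hx⟩ := Set.mem_iUnion.1 hs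
    obtain ⟨y, hy⟩ := Set.mem_iUnion.1 ht
    exact ((hsc1 x s hx _ (hinf x)).trans (hsc2 _ x.2 _ y.2)).trans (hsc1 y _ (hinf y) t hy)
  choose R hRrej hR1 hR2 using hT
  let PP := {p : Mem × Mem // out p.1 = out p.2 ∧ out p.1 ∈ Z}
  let U : Set Q := Z ∪ ⋃ p : PP, R p.1.1 p.1.2 p.2.1
  have hUrej : ¬ RabinAcc E F U := by
    intro h
    rcases rabin_union E F _ _ h with h | h
    · exact hZrej h
    · obtain ⟨p, hp⟩ := rabin_iUnion E F _ h
      exact hRrej _ _ _ hp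
  let stepU : Mem → Mem → Prop := fun y z => out y ∈ U ∧ ∃ a, z = upd y a
  have hmono : ∀ x x' (h : out x = out x'), out x ∈ Z → ∀ y z,
      ReflTransGen (fun y z => out y ∈ R x x' h ∧ ∃ a, z = upd y a) y z → ReflTransGen stepU y z := by
    intro x x' h hz y z
    apply ReflTransGen.mono
    rintro a b ⟨h1, h2⟩
    exact ⟨Or.inr (Set.mem_iUnion.2 ⟨⟨(x, x'), h, hz⟩, h1⟩), h2⟩
  have hfib : ∀ x x', out x = out x' → out x ∈ Z → ReflTransGen stepU x' x := fun x x' h hz =>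
    hmono x x' h hz _ _ (hR1 x x' h)
  have hlift : ∀ s t, TransGen stepZ s t → t ∈ Z → ∀ x y, out x = s → out y = t → TransGen stepU x y := by
    intro s t hst htZ
    induction hst using TransGen.head_induction_on with
    | single h =>
      obtain ⟨hZ, a, m1, e1, e2⟩ := h
      intro x y hx hy
      refine TransGen.trans_right (hfib m1 x (by rw [e1, hx]) (by rwa [e1])) ?_
      refine TransGen.trans_left (TransGen.single (b := upd m1 a) ⟨Or.inl (by rwa [e1]), a, rfl⟩) ?_
      exact hfib y _ (by rw [hy, e2]) (by rwa [hy])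
    | head h _ ih =>
      obtain ⟨hZ, a, m1, e1, e2⟩ := h
      intro x y hx hy
      refine TransGen.trans_right (hfib m1 x (by rw [e1, hx]) (by rwa [e1])) ?_
      exact TransGen.head (b := upd m1 a) ⟨Or.inl (by rwa [e1]), a, rfl⟩ (ih _ y e2 hy)
  have hover : ∀ s ∈ Z, ∃ x, out x = s := by
    intro s hs
    obtain ⟨x, hx⟩ := Set.mem_iUnion.1 hs
    obtain ⟨k, -, e⟩ := hx 0
    obtain ⟨y, hy, -⟩ := hρ x k
    exact ⟨y, hy.trans e⟩
  let Cor : D × Mem → Prop := fun p => ∀ w, DAcc δ β p.1 w ↔ w ∈ LM M (RabinAcc E F) (out p.2)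
  let St : D × Mem → D × Mem → Prop := fun p p' =>
    out p.2 ∈ U ∧ ∃ a, p'.1 = δ p.1 a ∧ p'.2 = upd p.2 a
  have hCor : ∀ p p', Cor p → St p p' → Cor p' := by
    rintro ⟨d, x⟩ ⟨d', x'⟩ h ⟨-, a, rfl, rfl⟩ w
    show DAcc δ β (δ d a) w ↔ w ∈ LM M _ (out (upd x a))
    rw [dacc_cons, ← hG.res]; exact h _
  have hprod : ∀ x y, TransGen stepU x y → ∀ d, Cor (d, x) → ∃ d', TransGen St (d, x) (d', y) ∧ Cor (d', y) := by
    intro x y h d hd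
    induction h with
    | single h =>
      obtain ⟨h1, a, rfl⟩ := h
      have : St (d, x) (δ d a, upd x a) := ⟨h1, a, rfl, rfl⟩
      exact ⟨_, TransGen.single this, hCor _ _ hd this⟩
    | @tail b c _ h ih =>
      obtain ⟨d', i1, i2⟩ := ih
      obtain ⟨h1, a, rfl⟩ := h
      have : St (d', b) (δ d' a, upd b a) := ⟨h1, a, rfl, rfl⟩
      exact ⟨_, i1.tail this, hCor _ _ i2 this⟩
  obtain ⟨k0, hk0⟩ := infOcc_eventually r
  have hIne : r k0 ∈ InfOcc r := hk0 k0 le_rfl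
  let Inv : D × Mem → Prop := fun p => Cor p ∧ ∃ y, out y ∈ Z ∧ ReflTransGen stepU p.2 y
  let G : Option U → D × Mem → Prop := fun o p => match o with
    | none => p.1 ∈ β
    | some s => out p.2 = s.1
  have hZt : ∀ d x y, Inv (d, x) → out y ∈ Z → TransGen stepU x y := by
    rintro d x y ⟨-, z, hz, hxz⟩ hy
    exact TransGen.trans_right hxz (hlift _ _ (hsc _ hz _ hy) hy _ _ rfl rfl)
  have H : ∀ p, Inv p → ∀ o, ∃ p', TransGen St p p' ∧ G o p' ∧ Inv p' := by
    rintro ⟨d, x⟩ hp o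
    rcases o with _ | ⟨s, hs⟩
    · obtain ⟨d', h1, h2⟩ := hprod _ _ (hZt d x (r k0) hp (hIZ _ hIne)) d hp.1
      have h3 := (h2 _).2 (hG.tail m w hw k0)
      obtain ⟨j, -, hj⟩ := h3 0
      have : ∀ j, ReflTransGen St (d', r k0) (drun δ d' (fun i => w (i + k0)) j, r (j + k0)) ∧
          Cor (drun δ d' (fun i => w (i + k0)) j, r (j + k0)) := by
        intro j
        induction j with
        | zero => simp only [drun, Nat.zero_add]; exact ⟨ReflTransGen.refl, h2⟩
        | succ j ih =>
          have h : St (drun δ d' (fun i => w (i + k0)) j, r (j + k0))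
              (drun δ d' (fun i => w (i + k0)) (j + 1), r (j + 1 + k0)) := by
            refine ⟨Or.inl (hIZ _ (hk0 _ (by omega))), w (j + k0), rfl, ?_⟩
            show r (j + 1 + k0) = _
            rw [Nat.add_right_comm]
            rfl
          exact ⟨ih.1.tail h, hCor _ _ ih.2 h⟩
      refine ⟨_, TransGen.trans_left h1 (this j).1, hj, (this j).2, _, hIZ _ (hk0 (j + k0) (by omega)), ReflTransGen.refl⟩
    · rcases hs with hs | hs
      · obtain ⟨y, hy⟩ := hover s hs
        obtain ⟨d', h1, h2⟩ := hprod _ _ (hZt d x y hp (hy ▸ hs)) d hp.1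
        exact ⟨_, h1, hy, h2, y, hy ▸ hs, ReflTransGen.refl⟩
      · obtain ⟨⟨⟨x1, x2⟩, he, hz⟩, hs'⟩ := Set.mem_iUnion.1 hs
        obtain ⟨y, hy, hy1, hy2⟩ := hR2 x1 x2 he s hs'
        obtain ⟨d', h1, h2⟩ := hprod _ _ (TransGen.trans_left (hZt d x x2 hp (by rw [← he]; exact hz))
          (hmono x1 x2 he hz _ _ hy1)) d hp.1
        exact ⟨_, h1, hy, h2, x1, hz, hmono x1 x2 he hz _ _ hy2⟩
  obtain ⟨d, hd⟩ := hG.dres (r k0)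
  obtain ⟨f, hf0, hf1, hf2⟩ := inf_path St Inv G H (d, r k0) ⟨hd, _, hIZ _ hIne, ReflTransGen.refl⟩
  choose hfU v hv1 hv2 using hf1
  have e1 : ∀ n, drun δ d v n = (f n).1 := by
    intro n
    induction n with
    | zero => rw [hf0]; rfl
    | succ n ih => simp only [drun]; rw [ih, hv1]
  have e2 : ∀ n, drun upd (r k0) v n = (f n).2 := by
    intro n
    induction n with
    | zero => rw [hf0]; rfl
    | succ n ih => simp only [drun]; rw [ih, hv2]
  have hvL : v ∈ LM M (RabinAcc E F) (out (r k0)) := by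
    rw [← hd]
    intro n
    obtain ⟨k, hk, h⟩ := hf2 none n
    exact ⟨k, hk, by rw [e1]; exact h⟩
  have hacc := hG.good _ _ hvL
  have : InfOcc (fun n => out (drun upd (r k0) v n)) = U := by
    ext s
    simp only [e2]
    constructor
    · intro h
      obtain ⟨k, -, e⟩ := h 0
      rw [← e]; exact hfU k
    · intro h n
      exact hf2 (some ⟨s, h⟩) n
  rw [this] at hacc
  exact hUrej hacc
/-! ### From transition-based Büchi GFG to deterministic -/

/-- Finite runs. -/
def nrun (N : Q → A → Q → Prop) : Q → List A → Q → Prop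
  | q, [], q' => q = q'
  | q, a :: v, q' => ∃ q1, N q a q1 ∧ nrun N q1 v q'

/-- Finite runs containing an accepting step. -/
def arun (Acc N : Q → A → Q → Prop) : Q → List A → Q → Prop
  | _, [], _ => False
  | q, a :: v, q' => (∃ q1, Acc q a q1 ∧ nrun N q1 v q') ∨ ∃ q1, N q a q1 ∧ arun Acc N q1 v q'

/-- The union of accepting and nonaccepting transitions. -/
def NN (Acc Non : Q → A → Q → Prop) (q : Q) (a : A) (q' : Q) : Prop := Acc q a q' ∨ Non q a q'

/-- Words over which no run sees an accepting step. -/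
def Safe (Acc Non : Q → A → Q → Prop) (p : Q) : Set (List A) :=
  {v | ∀ p', ¬ arun Acc (NN Acc Non) p v p'}

/-- Prepend a finite word. -/
def appW (v : List A) (w : ℕ → A) : ℕ → A := v.foldr consW w

theorem appW_append (v u : List A) (w : ℕ → A) : appW (v ++ u) w = appW v (appW u w) := by
  simp [appW]

theorem nrun_append {N : Q → A → Q → Prop} {v u : List A} {q x y : Q} (h1 : nrun N q v x)
    (h2 : nrun N x u y) : nrun N q (v ++ u) y := by
  induction v generalizing q with
  | nil => cases h1; exact h2
  | cons a v ih => obtain ⟨q1, h, h'⟩ := h1; exact ⟨q1, h, ih h'⟩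

theorem arun_append {Acc N : Q → A → Q → Prop} {v u : List A} {q x y : Q}
    (h1 : nrun N q v x) (h2 : arun Acc N x u y) : arun Acc N q (v ++ u) y := by
  induction v generalizing q with
  | nil => cases h1; exact h2
  | cons a v ih => obtain ⟨q1, h, h'⟩ := h1; exact Or.inr ⟨q1, h, ih h'⟩

theorem nrun_of_arun {Acc Non : Q → A → Q → Prop} {v : List A} {q x : Q}
    (h : arun Acc (NN Acc Non) q v x) : nrun (NN Acc Non) q v x ∧ v ≠ [] := by
  induction v generalizing q with
  | nil => exact h.elim
  | cons a v ih =>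
    refine ⟨?_, by simp⟩
    rcases h with ⟨q1, h1, h2⟩ | ⟨q1, h1, h2⟩
    · exact ⟨q1, Or.inl h1, h2⟩
    · exact ⟨q1, h1, (ih h2).1⟩

/-- A strategy that forces an accepting step on each word of the language. -/
def HitStrat (Lq : Q → Set (ℕ → A)) (Acc Non : Q → A → Q → Prop) (q : Q) : Prop :=
  ∃ P : List A → Q → Prop, P [] q ∧
    (∀ v x, P v x → ∀ a, (∃ x', Acc x a x') ∨ ∃ x', Non x a x' ∧ P (v ++ [a]) x') ∧
    ∀ w ∈ Lq q, ∃ n, ∀ x, ¬ P (prefixWord w n) x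

/-- The working structure. -/
structure GoodB (Q0 : Set Q) (Lq : Q → Set (ℕ → A)) (Acc Non : Q → A → Q → Prop) : Prop where
  a : ∀ q a q', NN Acc Non q a q' → q ∈ Q0 ∧ q' ∈ Q0 ∧ ∀ w, consW a w ∈ Lq q ↔ w ∈ Lq q'
  b : ∀ (r : ℕ → Q) (w : ℕ → A), (∀ n, NN Acc Non (r n) (w n) (r (n + 1))) →
    (∀ n, ∃ k, n ≤ k ∧ Acc (r k) (w k) (r (k + 1))) → w ∈ Lq (r 0)
  c : ∀ q ∈ Q0, HitStrat Lq Acc Non q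

/-- `q` can dominate the set `K`. -/
def Dom (Acc Non : Q → A → Q → Prop) (K : Set (List A)) (q : Q) : Prop :=
  ∃ Rel : Set (List A) → Q → Prop, Rel K q ∧ ∀ K q, Rel K q → [] ∈ K ∧
    ∀ a, (∃ q', Acc q a q') ∨ ∃ q', Non q a q' ∧ Rel {v | a :: v ∈ K} q'

section
variable {Q0 : Set Q} {Lq : Q → Set (ℕ → A)} {Acc Non : Q → A → Q → Prop}

theorem dom_unfold {K : Set (List A)} {q : Q} (h : Dom Acc Non K q) : [] ∈ K ∧
    ∀ a, (∃ q', Acc q a q') ∨ ∃ q', Non q a q' ∧ Dom Acc Non {v | a :: v ∈ K} q' := by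
  obtain ⟨Rel, h1, h2⟩ := h
  refine ⟨(h2 K q h1).1, fun a => ?_⟩
  rcases (h2 K q h1).2 a with h | ⟨q', h, h'⟩
  · exact Or.inl h
  · exact Or.inr ⟨q', h, Rel, h', h2⟩

theorem dom_mono {K K' : Set (List A)} {q : Q} (hK : K ⊆ K') (h : Dom Acc Non K q) :
    Dom Acc Non K' q := by
  refine ⟨fun K' q => ∃ K, K ⊆ K' ∧ Dom Acc Non K q, ⟨K, hK, h⟩, ?_⟩
  rintro K' q ⟨K, hK, h⟩
  obtain ⟨h1, h2⟩ := dom_unfold h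
  refine ⟨hK h1, fun a => ?_⟩
  rcases h2 a with h | ⟨q', h, h'⟩
  · exact Or.inl h
  · exact Or.inr ⟨q', h, _, fun v hv => hK hv, h'⟩

theorem GoodB.total (h : GoodB Q0 Lq Acc Non) {q : Q} (hq : q ∈ Q0) (a : A) : ∃ q', NN Acc Non q a q' := by
  obtain ⟨P, h1, h2, -⟩ := h.c q hq
  rcases h2 _ _ h1 a with ⟨x, hx⟩ | ⟨x, hx, -⟩
  · exact ⟨x, Or.inl hx⟩
  · exact ⟨x, Or.inr hx⟩

theorem GoodB.nrun_total (h : GoodB Q0 Lq Acc Non) {q : Q} (hq : q ∈ Q0) (v : List A) :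
    ∃ q', nrun (NN Acc Non) q v q' := by
  induction v generalizing q with
  | nil => exact ⟨q, rfl⟩
  | cons a v ih =>
    obtain ⟨q1, h1⟩ := h.total hq a
    obtain ⟨q2, h2⟩ := ih (h.a _ _ _ h1).2.1
    exact ⟨q2, q1, h1, h2⟩

theorem GoodB.nrun_res (h : GoodB Q0 Lq Acc Non) {q q' : Q} (hq : q ∈ Q0) {v : List A}
    (hv : nrun (NN Acc Non) q v q') : q' ∈ Q0 ∧ ∀ w, appW v w ∈ Lq q ↔ w ∈ Lq q' := by
  induction v generalizing q with
  | nil => cases hv; exact ⟨hq, fun w => Iff.rfl⟩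
  | cons a v ih =>
    obtain ⟨q1, h1, h2⟩ := hv
    obtain ⟨-, i1, i2⟩ := h.a _ _ _ h1
    obtain ⟨j1, j2⟩ := ih i1 h2
    exact ⟨j1, fun w => (i2 _).trans (j2 w)⟩

theorem GoodB.res_eq (h : GoodB Q0 Lq Acc Non) {p q p' q' : Q} {a : A} (h1 : NN Acc Non p a p')
    (h2 : NN Acc Non q a q') (e : Lq p = Lq q) : Lq p' = Lq q' := by
  ext w
  rw [← (h.a _ _ _ h1).2.2, ← (h.a _ _ _ h2).2.2, e]

theorem safe_step {p p' : Q} {a : A} (h : NN Acc Non p a p') :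
    {v | a :: v ∈ Safe Acc Non p} ⊆ Safe Acc Non p' := fun v hv x hx =>
  hv x (Or.inr ⟨p', h, hx⟩)

theorem safe_run {p p' : Q} {v : List A} (h : nrun (NN Acc Non) p v p') :
    {u | v ++ u ∈ Safe Acc Non p} ⊆ Safe Acc Non p' := fun _ hv x hx =>
  hv x (arun_append h hx)

theorem GoodB.dom_safe (h : GoodB Q0 Lq Acc Non) {K : Set (List A)} {q : Q} (hq : q ∈ Q0)
    (hd : Dom Acc Non K q) : Safe Acc Non q ⊆ K := by
  intro v
  induction v generalizing q K with
  | nil => exact fun _ => (dom_unfold hd).1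
  | cons a v ih =>
    intro hv
    rcases (dom_unfold hd).2 a with ⟨q', h1⟩ | ⟨q', h1, h2⟩
    · obtain ⟨x, hx⟩ := h.nrun_total (h.a _ _ _ (Or.inl h1)).2.1 v
      exact (hv x (Or.inl ⟨q', h1, hx⟩)).elim
    · exact ih (h.a _ _ _ (Or.inr h1)).2.1 h2 (safe_step (Or.inr h1) hv)

theorem GoodB.hit_safe (h : GoodB Q0 Lq Acc Non) {q : Q} (hq : q ∈ Q0) {w : ℕ → A} (hw : w ∈ Lq q) :
    ∃ n, prefixWord w n ∉ Safe Acc Non q := by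
  by_contra hc
  push Not at hc
  obtain ⟨P, h1, h2, h3⟩ := h.c q hq
  obtain ⟨n, hn⟩ := h3 w hw
  have : ∀ n, ∃ x, P (prefixWord w n) x ∧ nrun (NN Acc Non) q (prefixWord w n) x := by
    intro n
    induction n with
    | zero => exact ⟨q, h1, rfl⟩
    | succ n ih =>
      obtain ⟨x, hx, hr⟩ := ih
      rw [prefixWord_succ]
      rcases h2 _ _ hx (w n) with ⟨x', hx'⟩ | ⟨x', hx', hp⟩
      · have := hc (n + 1) x'
        rw [prefixWord_succ] at this
        exact (this (arun_append hr (Or.inl ⟨x', hx', rfl⟩))).elim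
      · exact ⟨x', hp, nrun_append hr ⟨x', Or.inr hx', rfl⟩⟩
  obtain ⟨x, hx, -⟩ := this n
  exact hn x hx

/-- Dominated states. -/
def BB (Q0 : Set Q) (Lq : Q → Set (ℕ → A)) (Acc Non : Q → A → Q → Prop) : Set Q :=
  {q | q ∈ Q0 ∧ ∃ p ∈ Q0, Lq p = Lq q ∧ Dom Acc Non (Safe Acc Non p) q}

theorem GoodB.improve (h : GoodB Q0 Lq Acc Non) :
    GoodB Q0 Lq (fun q a q' => Acc q a q' ∨ (Non q a q' ∧ q ∉ BB Q0 Lq Acc Non ∧ q' ∈ BB Q0 Lq Acc Non))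
      (fun q a q' => Non q a q' ∧ (q ∈ BB Q0 Lq Acc Non ↔ q' ∈ BB Q0 Lq Acc Non)) := by
  have hsub : ∀ q a q', NN (fun q a q' => Acc q a q' ∨ (Non q a q' ∧ q ∉ BB Q0 Lq Acc Non ∧ q' ∈ BB Q0 Lq Acc Non))
      (fun q a q' => Non q a q' ∧ (q ∈ BB Q0 Lq Acc Non ↔ q' ∈ BB Q0 Lq Acc Non)) q a q' →
      NN Acc Non q a q' := by
    rintro q a q' ((h | h) | h)
    · exact Or.inl h
    · exact Or.inr h.1
    · exact Or.inr h.1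
  refine ⟨fun q a q' hh => h.a q a q' (hsub _ _ _ hh), ?_, ?_⟩
  · intro r w hr hacc
    by_cases hA : ∀ n, ∃ k, n ≤ k ∧ Acc (r k) (w k) (r (k + 1))
    · exact h.b r w (fun n => hsub _ _ _ (hr n)) hA
    exfalso
    push Not at hA
    obtain ⟨k, hk⟩ := hA
    obtain ⟨k1, hk1, hh⟩ := hacc k
    have hB1 := (hh.resolve_left (hk _ hk1)).2.2
    have hst : ∀ j, r (k1 + 1 + j) ∈ BB Q0 Lq Acc Non := by
      intro j
      induction j with
      | zero => exact hB1
      | succ j ih =>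
        rcases hr (k1 + 1 + j) with (h1 | h1) | h1
        · exact (hk _ (by omega) h1).elim
        · exact h1.2.2
        · exact h1.2.1 ih
    obtain ⟨k2, hk2, hh2⟩ := hacc (k1 + 1)
    obtain ⟨j, rfl⟩ := Nat.exists_eq_add_of_le hk2
    exact (hh2.resolve_left (hk _ (by omega))).2.1 (hst j)
  · intro q hq
    by_cases hqB : q ∈ BB Q0 Lq Acc Non
    · obtain ⟨-, p, hp, e, hd⟩ := hqB
      have hmem : ∀ v x, x ∈ Q0 → Dom Acc Non {u | v ++ u ∈ Safe Acc Non p} x →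
          (∃ p'', nrun (NN Acc Non) p v p'' ∧ Lq p'' = Lq x) → x ∈ BB Q0 Lq Acc Non := by
        rintro v x hx hd ⟨p'', h1, h2⟩
        exact ⟨hx, p'', (h.nrun_res hp h1).1, h2, dom_mono (safe_run h1) hd⟩
      refine ⟨fun v x => x ∈ Q0 ∧ Dom Acc Non {u | v ++ u ∈ Safe Acc Non p} x ∧
          ∃ p'', nrun (NN Acc Non) p v p'' ∧ Lq p'' = Lq x, ⟨hq, hd, p, rfl, e⟩, ?_, ?_⟩
      · rintro v x ⟨hx, hdx, hpx⟩ a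
        have hxB := hmem v x hx hdx hpx
        obtain ⟨p'', hp1, hp2⟩ := hpx
        rcases (dom_unfold hdx).2 a with ⟨x', h1⟩ | ⟨x', h1, h2⟩
        · exact Or.inl ⟨x', Or.inl h1⟩
        · right
          obtain ⟨p3, hp3⟩ := h.total (h.nrun_res hp hp1).1 a
          have hx' := (h.a _ _ _ (Or.inr h1)).2.1
          have hd' : Dom Acc Non {u | (v ++ [a]) ++ u ∈ Safe Acc Non p} x' := by
            simpa using h2
          have hp' : ∃ p'', nrun (NN Acc Non) p (v ++ [a]) p'' ∧ Lq p'' = Lq x' :=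
            ⟨p3, nrun_append hp1 ⟨p3, hp3, rfl⟩, h.res_eq hp3 (Or.inr h1) hp2⟩
          exact ⟨x', ⟨h1, iff_of_true hxB (hmem _ _ hx' hd' hp')⟩, hx', hd', hp'⟩
      · intro w hw
        rw [← e] at hw
        obtain ⟨n, hn⟩ := h.hit_safe hp hw
        refine ⟨n, ?_⟩
        rintro x ⟨-, hd, -⟩
        have := (dom_unfold hd).1
        simp at this
        exact hn this
    · obtain ⟨P, h1, h2, h3⟩ := h.c q hq
      refine ⟨fun v x => P v x ∧ x ∉ BB Q0 Lq Acc Non, ⟨h1, hqB⟩, ?_, ?_⟩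
      · rintro v x ⟨hx, hxB⟩ a
        rcases h2 v x hx a with ⟨x', h⟩ | ⟨x', h, h'⟩
        · exact Or.inl ⟨x', Or.inl h⟩
        · by_cases hB : x' ∈ BB Q0 Lq Acc Non
          · exact Or.inl ⟨x', Or.inr ⟨h, hxB, hB⟩⟩
          · exact Or.inr ⟨x', ⟨h, iff_of_false hxB hB⟩, h', hB⟩
      · intro w hw
        obtain ⟨n, hn⟩ := h3 w hw
        exact ⟨n, fun x hx => hn x hx.1⟩

end

theorem exists_closed [Finite Q] [Finite A] {Q0 : Set Q} {Lq : Q → Set (ℕ → A)} (n : ℕ) :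
    ∀ (Acc Non : Q → A → Q → Prop), GoodB Q0 Lq Acc Non →
    {t : Q × A × Q | Non t.1 t.2.1 t.2.2}.ncard = n →
    ∃ Acc Non : Q → A → Q → Prop, GoodB Q0 Lq Acc Non ∧ ∀ q a q', Non q a q' →
      (q ∈ BB Q0 Lq Acc Non ↔ q' ∈ BB Q0 Lq Acc Non) := by
  induction n using Nat.strong_induction_on with
  | _ n ih =>
  intro Acc Non h hn
  by_cases hc : ∀ q a q', Non q a q' → (q ∈ BB Q0 Lq Acc Non ↔ q' ∈ BB Q0 Lq Acc Non)
  · exact ⟨Acc, Non, h, hc⟩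
  · refine ih _ ?_ _ _ h.improve rfl
    rw [← hn]
    push Not at hc
    obtain ⟨q, a, q', h1, h2⟩ := hc
    apply Set.ncard_lt_ncard _ (Set.toFinite _)
    refine ⟨fun t ht => ht.1, fun hh => ?_⟩
    have := (hh (show (q, a, q') ∈ _ from h1)).2
    simp only at this
    tauto
theorem prefixWord_mono (w : ℕ → A) (n k : ℕ) : prefixWord w n <+: prefixWord w (n + k) := by
  induction k with
  | zero => exact List.prefix_rfl
  | succ k ih =>
    rw [← Nat.add_assoc, prefixWord_succ]
    exact ih.trans (List.prefix_append _ _)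

section
variable {Q0 : Set Q} {Lq : Q → Set (ℕ → A)} {Acc Non : Q → A → Q → Prop}

open Relation in
theorem GoodB.bb_all (h : GoodB Q0 Lq Acc Non) (hcl : ∀ q a q', Non q a q' →
      (q ∈ BB Q0 Lq Acc Non ↔ q' ∈ BB Q0 Lq Acc Non)) {q : Q} (hq : q ∈ Q0) :
    q ∈ BB Q0 Lq Acc Non := by
  by_contra hqB
  obtain ⟨P, hP1, hP2, hP3⟩ := h.c q hq
  let P1 : List A → Q → Prop := fun v x => P v x ∧ x ∈ Q0 ∧ x ∉ BB Q0 Lq Acc Non ∧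
    (∀ w, w ∈ Lq x ↔ appW v w ∈ Lq q) ∧ ∀ u, u <+: v → ∃ y, P u y
  have hP1s : ∀ v x, P1 v x → ∀ a, (∃ x', Acc x a x') ∨ ∃ x', Non x a x' ∧ P1 (v ++ [a]) x' := by
    rintro v x ⟨h1, h2, h3, h4, h5⟩ a
    rcases hP2 v x h1 a with hh | ⟨x', i1, i2⟩
    · exact Or.inl hh
    · refine Or.inr ⟨x', i1, i2, (h.a _ _ _ (Or.inr i1)).2.1, fun hB => h3 ((hcl _ _ _ i1).2 hB), ?_, ?_⟩
      · intro w
        rw [appW_append, ← h4, ← (h.a _ _ _ (Or.inr i1)).2.2]; rfl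
      · intro u hu
        rw [List.prefix_concat_iff] at hu
        rcases hu with rfl | hu
        · exact ⟨_, i2⟩
        · exact h5 u hu
  have hext : ∀ v x, P1 v x → ∀ p ∈ Q0, Lq p = Lq x → ∃ u y, u ∉ Safe Acc Non p ∧ P1 (v ++ u) y := by
    intro v x hx p hp e
    by_contra hc
    push Not at hc
    apply hx.2.2.1
    refine ⟨hx.2.1, p, hp, e, fun K y => ∃ u, K = {s | u ++ s ∈ Safe Acc Non p} ∧ P1 (v ++ u) y,
      ⟨[], by simp, by simpa using hx⟩, ?_⟩
    rintro K y ⟨u, rfl, hy⟩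
    refine ⟨?_, fun a => ?_⟩
    · show u ++ [] ∈ Safe Acc Non p
      rw [List.append_nil]
      by_contra hu
      exact hc u y hu hy
    · rcases hP1s _ _ hy a with hh | ⟨x', i1, i2⟩
      · exact Or.inl hh
      · refine Or.inr ⟨x', i1, u ++ [a], ?_, ?_⟩
        · ext s; simp
        · simpa using i2
  let St : List A × Q × Bool → List A × Q × Bool → Prop := fun s t =>
    ∃ a, t.1 = s.1 ++ [a] ∧ NN Acc Non s.2.1 a t.2.1 ∧
      (t.2.2 = true → s.2.2 = true ∨ Acc s.2.1 a t.2.1)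
  have hkeep : ∀ u v p p' fl, nrun (NN Acc Non) p u p' → ReflTransGen St (v, p, fl) (v ++ u, p', fl) := by
    intro u
    induction u with
    | nil => intro v p p' fl hr; cases hr; rw [List.append_nil]
    | cons a u ih =>
      rintro v p p' fl ⟨q1, i1, i2⟩
      have := ih (v ++ [a]) q1 p' fl i2
      rw [List.append_assoc] at this
      exact ReflTransGen.head (b := (v ++ [a], q1, fl)) ⟨a, rfl, i1, Or.inl⟩ this
  have htrue : ∀ u v p p' fl, arun Acc (NN Acc Non) p u p' → TransGen St (v, p, fl) (v ++ u, p', true) := by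
    intro u
    induction u with
    | nil => intro v p p' fl hr; exact hr.elim
    | cons a u ih =>
      rintro v p p' fl (⟨q1, i1, i2⟩ | ⟨q1, i1, i2⟩)
      · have := hkeep u (v ++ [a]) q1 p' true i2
        rw [List.append_assoc] at this
        exact TransGen.head' ⟨a, rfl, Or.inl i1, fun _ => Or.inr i1⟩ this
      · have := ih (v ++ [a]) q1 p' fl i2
        rw [List.append_assoc] at this
        exact TransGen.head (b := (v ++ [a], q1, fl)) ⟨a, rfl, i1, Or.inl⟩ this
  have hfalse : ∀ u v p p' fl, arun Acc (NN Acc Non) p u p' → TransGen St (v, p, fl) (v ++ u, p', false) := by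
    intro u v p p' fl hr
    obtain ⟨i1, i2⟩ := nrun_of_arun hr
    cases u with
    | nil => exact (i2 rfl).elim
    | cons a u =>
      obtain ⟨q1, j1, j2⟩ := i1
      have := hkeep u (v ++ [a]) q1 p' false j2
      rw [List.append_assoc] at this
      exact TransGen.head' ⟨a, rfl, j1, by simp⟩ this
  let Inv : List A × Q × Bool → Prop := fun s => s.2.1 ∈ Q0 ∧ ∃ x, P1 s.1 x ∧ Lq s.2.1 = Lq x
  have H : ∀ s, Inv s → ∀ b : Bool, ∃ t, TransGen St s t ∧ (t.2.2 = b ∧ Inv t) ∧ Inv t := by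
    rintro ⟨v, p, fl⟩ ⟨hp, x, hx, e⟩ b
    obtain ⟨u, y, hu, hy⟩ := hext v x hx p hp e
    simp only [Safe, Set.mem_setOf_eq, not_forall, not_not] at hu
    obtain ⟨p', hp'⟩ := hu
    have hI : Inv (v ++ u, p', b) := by
      obtain ⟨j1, j2⟩ := h.nrun_res hp (nrun_of_arun hp').1
      refine ⟨j1, y, hy, ?_⟩
      ext w
      show w ∈ Lq p' ↔ _
      rw [← j2, hy.2.2.2.1, appW_append, ← hx.2.2.2.1]
      simp only at e
      rw [e]
    refine ⟨(v ++ u, p', b), ?_, ⟨rfl, hI⟩, hI⟩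
    cases b
    · exact hfalse u v p p' fl hp'
    · exact htrue u v p p' fl hp'
  have hI0 : Inv ([], q, false) :=
    ⟨hq, q, ⟨hP1, hq, hqB, fun w => Iff.rfl, fun u hu => by
      rw [List.prefix_nil] at hu; subst hu; exact ⟨q, hP1⟩⟩, rfl⟩
  obtain ⟨f, hf0, hf1, hf2⟩ := inf_path St Inv (fun b t => t.2.2 = b ∧ Inv t) H _ hI0
  choose w hw1 hw2 hw3 using hf1
  have hpre : ∀ n, (f n).1 = prefixWord w n := by
    intro n
    induction n with
    | zero => rw [hf0]; rfl
    | succ n ih => rw [hw1, ih, prefixWord_succ]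
  have hacc : ∀ n, ∃ k, n ≤ k ∧ Acc (f k).2.1 (w k) (f (k + 1)).2.1 := by
    intro n
    by_contra hc
    push Not at hc
    obtain ⟨m, hm, hmf, -⟩ := hf2 false n
    have : ∀ j, (f (m + j)).2.2 = false := by
      intro j
      induction j with
      | zero => exact hmf
      | succ j ih =>
        rw [← Bool.not_eq_true]
        intro ht
        rcases hw3 (m + j) ht with h1 | h1
        · rw [ih] at h1; simp at h1
        · exact hc _ (by omega) h1
    obtain ⟨m2, hm2, h2, -⟩ := hf2 true m
    obtain ⟨j, rfl⟩ := Nat.exists_eq_add_of_le hm2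
    rw [this j] at h2
    simp at h2
  have hwL := h.b (fun n => (f n).2.1) w hw2 hacc
  simp only [hf0] at hwL
  obtain ⟨n, hn⟩ := hP3 w hwL
  obtain ⟨m, hm, -, -, x, hx, -⟩ := hf2 true n
  obtain ⟨j, rfl⟩ := Nat.exists_eq_add_of_le hm
  obtain ⟨y, hy⟩ := hx.2.2.2.2 (prefixWord w n) (by rw [hpre]; exact prefixWord_mono w n j)
  exact hn y hy

theorem GoodB.self_good [Finite Q] (h : GoodB Q0 Lq Acc Non) (hcl : ∀ q a q', Non q a q' →
      (q ∈ BB Q0 Lq Acc Non ↔ q' ∈ BB Q0 Lq Acc Non)) {q : Q} (hq : q ∈ Q0) :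
    ∃ p ∈ Q0, Lq p = Lq q ∧ Dom Acc Non (Safe Acc Non p) p ∧ Dom Acc Non (Safe Acc Non p) q := by
  let S : Set Q := {p | p ∈ Q0 ∧ Lq p = Lq q ∧ Dom Acc Non (Safe Acc Non p) q}
  have hS : S.Nonempty := by
    obtain ⟨-, p, h1, h2, h3⟩ := h.bb_all hcl hq
    exact ⟨p, h1, h2, h3⟩
  obtain ⟨p, hp, hmax⟩ := Set.Finite.exists_maximalFor (Safe Acc Non) S (Set.toFinite _) hS
  obtain ⟨-, p', h1, h2, h3⟩ := h.bb_all hcl hp.1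
  have hsub := h.dom_safe hp.1 h3
  have hp' : p' ∈ S := ⟨h1, h2.trans hp.2.1, dom_mono hsub hp.2.2⟩
  exact ⟨p, hp.1, hp.2.1, dom_mono (hmax hp' hsub) h3, hp.2.2⟩

theorem GoodB.dbw [Finite Q] (h : GoodB Q0 Lq Acc Non) (hcl : ∀ q a q', Non q a q' →
      (q ∈ BB Q0 Lq Acc Non ↔ q' ∈ BB Q0 Lq Acc Non)) {q0 : Q} (hq0 : q0 ∈ Q0) :
    ∃ (δ : Q × Q × Bool → A → Q × Q × Bool) (β : Set (Q × Q × Bool)) (s0 : Q × Q × Bool),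
      ∀ w, DAcc δ β s0 w ↔ w ∈ Lq q0 := by
  classical
  let Inv : Q × Q × Bool → Prop := fun s => s.1 ∈ Q0 ∧ s.2.1 ∈ Q0 ∧ Lq s.1 = Lq s.2.1 ∧
    Dom Acc Non (Safe Acc Non s.1) s.1 ∧ Dom Acc Non (Safe Acc Non s.1) s.2.1
  have hstep : ∀ s a, ∃ t : Q × Q × Bool, Inv s → Inv t ∧ NN Acc Non s.2.1 a t.2.1 ∧
      (t.2.2 = true → Acc s.2.1 a t.2.1) ∧
      (t.2.2 = false → Safe Acc Non t.1 = {v | a :: v ∈ Safe Acc Non s.1}) := by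
    rintro ⟨p, q, fl⟩ a
    by_cases hI : Inv (p, q, fl)
    swap
    · exact ⟨(p, q, fl), fun h => (hI h).elim⟩
    obtain ⟨hp, hq, e, hd1, hd2⟩ := hI
    simp only at hp hq e hd1 hd2
    by_cases hA : ∃ q', Acc q a q'
    · obtain ⟨q', hq'⟩ := hA
      obtain ⟨p', i1, i2, i3, i4⟩ := h.self_good hcl (h.a _ _ _ (Or.inl hq')).2.1
      exact ⟨(p', q', true), fun _ => ⟨⟨i1, (h.a _ _ _ (Or.inl hq')).2.1, i2, i3, i4⟩, Or.inl hq',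
        fun _ => hq', by simp⟩⟩
    · obtain ⟨q', j1, j2⟩ := ((dom_unfold hd2).2 a).resolve_left hA
      have hsafe : [a] ∈ Safe Acc Non p := (dom_unfold j2).1
      have hA' : ¬ ∃ p', Acc p a p' := by
        rintro ⟨p', hp'⟩
        exact hsafe p' (Or.inl ⟨p', hp', rfl⟩)
      obtain ⟨p', k1, k2⟩ := ((dom_unfold hd1).2 a).resolve_left hA'
      have hp' := (h.a _ _ _ (Or.inr k1)).2.1
      have heq : Safe Acc Non p' = {v | a :: v ∈ Safe Acc Non p} :=
        Set.Subset.antisymm (h.dom_safe hp' k2) (safe_step (Or.inr k1))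
      refine ⟨(p', q', false), fun _ => ⟨⟨hp', (h.a _ _ _ (Or.inr j1)).2.1,
        h.res_eq (Or.inr k1) (Or.inr j1) e, ?_, ?_⟩, Or.inr j1, by simp, fun _ => heq⟩⟩
      · show Dom Acc Non (Safe Acc Non p') p'
        rw [heq]; exact k2
      · show Dom Acc Non (Safe Acc Non p') q'
        rw [heq]; exact j2
  choose δ hδ using hstep
  obtain ⟨p0, i1, i2, i3, i4⟩ := h.self_good hcl hq0
  refine ⟨δ, {s | s.2.2 = true}, (p0, q0, false), fun w => ?_⟩
  set s := drun δ (p0, q0, false) w with hs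
  have hInv : ∀ n, Inv (s n) := by
    intro n
    induction n with
    | zero => exact ⟨i1, hq0, i2, i3, i4⟩
    | succ n ih => exact (hδ (s n) (w n) ih).1
  have hst : ∀ n, _ := fun n => (hδ (s n) (w n) (hInv n)).2
  constructor
  · intro hd
    refine h.b (fun n => (s n).2.1) w (fun n => (hst n).1) (fun n => ?_)
    obtain ⟨k, hk, hb⟩ := hd (n + 1)
    obtain ⟨j, rfl⟩ := Nat.exists_eq_add_of_le hk
    refine ⟨n + j, by omega, (hst (n + j)).2.1 ?_⟩
    rw [show n + 1 + j = n + j + 1 by omega] at hb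
    exact hb
  · intro hw
    by_contra hc
    unfold DAcc at hc
    push Not at hc
    obtain ⟨n, hn⟩ := hc
    have htail : ∀ k, (fun i => w (i + k)) ∈ Lq (s k).2.1 := by
      intro k
      induction k with
      | zero => exact hw
      | succ k ih =>
        refine ((h.a _ _ _ (hst k).1).2.2 _).1 ?_
        convert ih using 1
        funext n
        cases n with
        | zero => simp [consW]
        | succ n => simp only [consW]; congr 1; omega
    have ht := htail n
    rw [← (hInv n).2.2.1] at ht
    obtain ⟨j, hj⟩ := h.hit_safe (hInv n).1 ht
    have : ∀ j, Safe Acc Non (s (j + n)).1 =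
        {v | prefixWord (fun i => w (i + n)) j ++ v ∈ Safe Acc Non (s n).1} := by
      intro j
      induction j with
      | zero => simp [prefixWord_zero]
      | succ j ih =>
        have hf : (s (j + n + 1)).2.2 = false := by
          rw [← Bool.not_eq_true]
          exact hn _ (by omega)
        have := (hst (j + n)).2.2 hf
        rw [Nat.add_right_comm]
        refine this.trans ?_
        rw [ih, prefixWord_succ]
        ext v
        simp
    have h0 := (dom_unfold (hInv (j + n)).2.2.2.1).1
    rw [this] at h0
    simp at h0
    exact hj h0

end

theorem drun_eq_foldl {X : Type} (f : X → A → X) (x : X) (w : ℕ → A) (n : ℕ) :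
    drun f x w n = (prefixWord w n).foldl f x := by
  induction n with
  | zero => rfl
  | succ n ih => rw [prefixWord_succ, List.foldl_append]; simp only [drun]; rw [ih]; rfl

theorem goodB_init [Finite Q] {D Mem ι : Type} [Finite Mem] {M : Auto A Q} {E F : ι → Set Q}
    {δ : D → A → D} {β : Set D} {upd : Mem → A → Mem} {out : Mem → Q}
    (hG : GoodT M E F δ β upd out) (hT : TightT E F upd out) :
    GoodB (Set.range out) (LM M (RabinAcc E F))
      (fun q a q' => N0 upd out q a q' ∧ Sound (LM M (RabinAcc E F)) upd out q')
      (fun q a q' => N0 upd out q a q' ∧ ¬ Sound (LM M (RabinAcc E F)) upd out q') := by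
  refine ⟨?_, ?_, ?_⟩
  · intro q a q' hh
    have : N0 upd out q a q' := by rcases hh with hh | hh <;> exact hh.1
    obtain ⟨m, rfl, rfl⟩ := this
    exact ⟨⟨_, rfl⟩, ⟨_, rfl⟩, hG.res m a⟩
  · intro r w hr hacc
    obtain ⟨x, hx⟩ := infOcc_pigeon (fun n => r (n + 1))
      (fun n => Sound (LM M (RabinAcc E F)) upd out (r (n + 1)))
      (fun n => by obtain ⟨k, hk, h⟩ := hacc n; exact ⟨k, hk, h.2⟩)
    obtain ⟨k, -, h1, h2⟩ := hx 0
    rw [h2] at h1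
    refine h1 r w (fun n => by rcases hr n with hh | hh <;> exact hh.1) (fun n => ?_)
    obtain ⟨k, hk, -, e⟩ := hx n
    exact ⟨k + 1, by omega, e⟩
  · rintro _ ⟨m, rfl⟩
    refine ⟨fun v x => x = out (v.foldl upd m) ∧ ∀ u, u ≠ [] → u <+: v →
      ¬ Sound (LM M (RabinAcc E F)) upd out (out (u.foldl upd m)), ⟨rfl, ?_⟩, ?_, ?_⟩
    · intro u hu hp
      rw [List.prefix_nil] at hp
      exact (hu hp).elim
    · rintro v _ ⟨rfl, hv⟩ a
      have hN : N0 upd out (out (v.foldl upd m)) a (out ((v ++ [a]).foldl upd m)) :=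
        ⟨_, rfl, by simp⟩
      by_cases hS : Sound (LM M (RabinAcc E F)) upd out (out ((v ++ [a]).foldl upd m))
      · exact Or.inl ⟨_, hN, hS⟩
      · refine Or.inr ⟨_, ⟨hN, hS⟩, rfl, ?_⟩
        intro u hu hp
        rw [List.prefix_concat_iff] at hp
        rcases hp with rfl | hp
        · exact hS
        · exact hv u hu hp
    · intro w hw
      obtain ⟨k, hk, hS⟩ := sound_inf hG hT m w hw 1
      refine ⟨k, ?_⟩
      rintro x ⟨-, hx⟩
      rw [drun_eq_foldl] at hS
      refine hx _ ?_ List.prefix_rfl hS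
      intro hnil
      have := congrArg List.length hnil
      simp [prefixWord] at this
      omega

theorem complete_det {Q' : Type} [Finite Q'] (D : Auto A Q') (β : Set Q') (hD : D.IsDet) :
    ∃ (δ : Option Q' → A → Option Q') (d0 : Option Q'),
      ∀ w, DAcc δ (some '' β) d0 w ↔ w ∈ D.Lang (BuchiAcc β) := by
  classical
  obtain ⟨⟨q0, hq0⟩, hsub⟩ := hD
  let δ : Option Q' → A → Option Q' := fun d a => d.bind fun q =>
    if h : (D.next q a).Nonempty then some h.some else none
  have hδ : ∀ q a q', q' ∈ D.next q a → δ (some q) a = some q' := by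
    intro q a q' h
    have hne : (D.next q a).Nonempty := ⟨q', h⟩
    simp only [δ, Option.bind_some, dif_pos hne]
    rw [hsub q a hne.some_mem h]
  have hδ' : ∀ q a q', δ (some q) a = some q' → q' ∈ D.next q a := by
    intro q a q' h
    simp only [δ, Option.bind_some] at h
    split_ifs at h with hne
    · cases h; exact hne.some_mem
  refine ⟨δ, some q0, fun w => ⟨fun h => ?_, ?_⟩⟩
  · have hall : ∀ n, ∃ q, drun δ (some q0) w n = some q := by
      intro n
      obtain ⟨k, hk, q, -, e⟩ := h n
      by_contra hc
      have hnone : drun δ (some q0) w n = none := by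
        cases hh : drun δ (some q0) w n with
        | none => rfl
        | some x => exact (hc ⟨x, hh⟩).elim
      have : ∀ j, drun δ (some q0) w (n + j) = none := by
        intro j
        induction j with
        | zero => exact hnone
        | succ j ih => show δ (drun δ (some q0) w (n + j)) _ = none; rw [ih]; rfl
      obtain ⟨j, rfl⟩ := Nat.exists_eq_add_of_le hk
      rw [this j] at e
      simp at e
    choose r hr using hall
    refine ⟨r, ⟨?_, fun i => ?_⟩, (buchi_iff r β).2 fun n => ?_⟩
    · rw [hq0]
      have := hr 0
      simp only [drun, Option.some.injEq] at this
      exact this.symm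
    · apply hδ'
      rw [← hr, ← hr]; rfl
    · obtain ⟨k, hk, q, hq, e⟩ := h n
      rw [hr, Option.some.injEq] at e
      exact ⟨k, hk, e ▸ hq⟩
  · rintro ⟨r, ⟨h0, h1⟩, hacc⟩
    rw [hq0] at h0
    have hr : ∀ n, drun δ (some q0) w n = some (r n) := by
      intro n
      induction n with
      | zero => rw [show r 0 = q0 from h0]; rfl
      | succ n ih => simp only [drun]; rw [ih]; exact hδ _ _ _ (h1 n)
    intro n
    obtain ⟨k, hk, hb⟩ := (buchi_iff r β).1 hacc n
    exact ⟨k, hk, r k, hb, (hr k).symm⟩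

/-- There is a constant `c` such that every GFG Rabin automaton with
`n` states recognizing a DBW-realizable language has an equivalent DBW with at most
`c · n²` states. -/
theorem stmt15 :
    ∃ c : ℕ, ∀ (A Q ι : Type) [Fintype A] [Fintype Q] [Fintype ι],
      ∀ (M : Auto A Q) (E F : ι → Set Q),
        IsGFG M (RabinAcc E F) →
        (∃ (Q' : Type) (_ : Fintype Q') (D : Auto A Q') (β : Set Q'),
          D.IsDet ∧ D.Lang (BuchiAcc β) = M.Lang (RabinAcc E F)) →
        ∃ (Q' : Type) (instQ' : Fintype Q') (D : Auto A Q') (β : Set Q'),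
          D.IsDet ∧ D.Lang (BuchiAcc β) = M.Lang (RabinAcc E F) ∧
          @Fintype.card Q' instQ' ≤ c * (Fintype.card Q) ^ 2 := by
  refine ⟨2, ?_⟩
  intro A Q ι _ _ _ M E F ⟨g, hg⟩ ⟨Q', _, D, β, hdet, hL⟩
  obtain ⟨δ, d0, hd⟩ := complete_det D β hdet
  rw [hL] at hd
  obtain ⟨Mem, hfin, upd, out, m0, hG, hm0, hT⟩ := exists_tight M E F δ (some '' β) _
    (exists_goodT M E F δ (some '' β) d0 hd g hg)
  obtain ⟨Acc, Non, hB, hcl⟩ := exists_closed _ _ _ (goodB_init hG hT) rfl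
  obtain ⟨δ', β', s0, h⟩ := hB.dbw hcl ⟨m0, rfl⟩
  refine ⟨Q × Q × Bool, inferInstance, ⟨{s0}, fun s a => {δ' s a}⟩, β',
    ⟨⟨s0, rfl⟩, fun q a => Set.subsingleton_singleton⟩, ?_, ?_⟩
  · ext w
    rw [← hm0, ← h]
    constructor
    · rintro ⟨r, ⟨h0, h1⟩, hacc⟩
      have hr : ∀ n, drun δ' s0 w n = r n := by
        intro n
        induction n with
        | zero => exact (show r 0 = s0 from h0).symm
        | succ n ih => simp only [drun]; rw [ih]; exact (show r (n + 1) = _ from h1 n).symm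
      intro n
      obtain ⟨k, hk, hb⟩ := (buchi_iff r β').1 hacc n
      exact ⟨k, hk, by rwa [hr]⟩
    · intro hw
      exact ⟨drun δ' s0 w, ⟨rfl, fun i => rfl⟩, (buchi_iff _ _).2 hw⟩
  · simp only [Fintype.card_prod, Fintype.card_bool]
    apply le_of_eq
    ring

end GFG
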